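/- arXiv:2404.10695 — 6 statements merged into one kernel-verified Lean document; each statement's English description precedes it below -/
import Mathlib

section
/- For every integer n ≥ 1, the weak-coupling perturbative coefficient a_{2n} of the logarithm of the spectral trace of local ℙ² is recovered as the Mellin transform of the strong-coupling discontinuity: a_{2n} = ((−1)^n/(π i)) · ∫_0^∞ ħ^{-2n-1} · (Σ_{m=1}^∞ S_m e^{-4π²m/(3ħ)}) dħ, where the integral is over real ħ > 0 and the series converges for every ħ > 0. -/
open scoped Real
open MeasureTheory

noncomputable section

/-- The nonprincipal Dirichlet character modulo 3. -/
def chi (n : ℤ) : ℤ := if n % 3 = 1 then 1 else if n % 3 = 2 then -1 else 0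

/-- The weak-coupling Stokes constants of local ℙ². -/
def S (n : ℕ) : ℂ := 3 * Real.sqrt 3 * Complex.I * ∑ d ∈ n.divisors, (chi d : ℂ) / d

/-- The weak-coupling perturbative coefficients `a_{2n}` of the logarithm of the
spectral trace of local ℙ²: `a_{2n} = (−1)^{n−1} 3^{2n+1} B_{2n} B_{2n+1}(2/3) / (2n (2n+1)!)`. -/
def a (n : ℕ) : ℂ :=
  (-1 : ℂ) ^ (n - 1) * 3 ^ (2 * n + 1) * ((bernoulli (2 * n) : ℚ) : ℂ) *
      (((Polynomial.bernoulli (2 * n + 1)).eval (2 / 3 : ℚ) : ℚ) : ℂ) /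
    (((2 * n : ℕ) : ℂ) * (Nat.factorial (2 * n + 1) : ℂ))

lemma norm_chi_le_one (n : ℤ) : ‖(chi n : ℂ)‖ ≤ 1 := by
  unfold chi
  split_ifs <;> simp

lemma sin_two_pi_mul_two_thirds (n : ℕ) :
    Real.sin (2 * π * n * (2 / 3)) = -(√3 / 2) * chi n := by
  have h₁ : Real.sin (4 * π / 3) = -(√3 / 2) := by
    rw [show 4 * π / 3 = π / 3 + π by ring, Real.sin_add_pi, Real.sin_pi_div_three]
  have h₂ : Real.sin (8 * π / 3) = √3 / 2 := by
    rw [show 8 * π / 3 = π - π / 3 + 2 * π by ring, Real.sin_add_two_pi, Real.sin_pi_sub,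
      Real.sin_pi_div_three]
  have key (q r : ℕ) : Real.sin (2 * π * ((3 * q + r : ℕ) : ℝ) * (2 / 3)) =
      Real.sin (4 * π / 3 * r) := by
    rw [show 2 * π * ((3 * q + r : ℕ) : ℝ) * (2 / 3) =
      4 * π / 3 * r + ((2 * q : ℕ) : ℝ) * (2 * π) by push_cast; ring]
    exact Real.sin_add_nat_mul_two_pi _ _
  have hr : n % 3 < 3 := Nat.mod_lt _ (by norm_num)
  have hn := key (n / 3) (n % 3)
  rw [Nat.div_add_mod] at hn
  have hmod : ((n : ℤ) % 3) = ((n % 3 : ℕ) : ℤ) := by simp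
  rw [hn, chi, hmod]
  generalize n % 3 = r at hr
  interval_cases r
  · simp
  · simp [h₁]
  · rw [show 4 * π / 3 * ((2 : ℕ) : ℝ) = 8 * π / 3 by push_cast; ring, h₂]
    norm_num

lemma hasSum_chi_div_pow {k : ℕ} (hk : k ≠ 0) :
    HasSum (fun n : ℕ => (chi n : ℂ) / n / (n : ℂ) ^ (2 * k))
      ((-1 : ℂ) ^ k * (2 * π) ^ (2 * k + 1) / √3 / (2 * k + 1).factorial *
        (((Polynomial.bernoulli (2 * k + 1)).eval (2 / 3 : ℚ) : ℚ) : ℂ)) := by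
  have h := hasSum_one_div_nat_pow_mul_sin hk (x := 2 / 3) ⟨by norm_num, by norm_num⟩
  have hs : (√3 : ℝ) ≠ 0 := by positivity
  have hs' : (√3 : ℂ) ≠ 0 := by exact_mod_cast hs
  have heval : (Polynomial.map (algebraMap ℚ ℝ) (Polynomial.bernoulli (2 * k + 1))).eval
      (2 / 3 : ℝ) = (((Polynomial.bernoulli (2 * k + 1)).eval (2 / 3 : ℚ) : ℚ) : ℝ) := by
    have := Polynomial.eval_map_algebraMap (Polynomial.bernoulli (2 * k + 1))
      (algebraMap ℚ ℝ (2 / 3))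
    rw [Polynomial.aeval_algebraMap_apply_eq_algebraMap_eval] at this
    simpa using this
  rw [heval] at h
  convert! (Complex.hasSum_ofReal.mpr h).mul_left (-(2 / √3) : ℂ) using 1
  · ext n
    rw [sin_two_pi_mul_two_thirds]
    rcases eq_or_ne n 0 with rfl | hn
    · simp
    · have : (n : ℂ) ≠ 0 := by exact_mod_cast hn
      push_cast
      field_simp
      ring
  · push_cast
    field_simp
    ring

lemma S_eq_convolution (n : ℕ) :
    S n = 3 * √3 * Complex.I * LSeries.convolution (fun d => (chi d : ℂ) / d) 1 n := by
  rw [S, LSeries.convolution_def]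
  simp only [Pi.one_apply, mul_one]
  rw [Nat.sum_divisorsAntidiagonal (fun i _ => (chi i : ℂ) / i)]

lemma hasSum_S_div_pow {k : ℕ} (hk : k ≠ 0) :
    HasSum (fun m : ℕ => S (m + 1) / ((m : ℂ) + 1) ^ (2 * k))
      (3 * √3 * Complex.I * (((-1 : ℂ) ^ k * (2 * π) ^ (2 * k + 1) / √3 / (2 * k + 1).factorial *
        (((Polynomial.bernoulli (2 * k + 1)).eval (2 / 3 : ℚ) : ℚ) : ℂ)) *
      ((-1) ^ (k + 1) * 2 ^ (2 * k - 1) * π ^ (2 * k) * (bernoulli (2 * k) : ℚ) /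
        (2 * k).factorial))) := by
  have hterm (f : ℕ → ℂ) (n : ℕ) :
      LSeries.term f ((2 * k : ℕ) : ℂ) n = f n / (n : ℂ) ^ (2 * k) := by
    rcases eq_or_ne n 0 with rfl | hn
    · simp [hk]
    · rw [LSeries.term_of_ne_zero hn, Complex.cpow_natCast]
  have h₁ : LSeriesHasSum (fun d => (chi d : ℂ) / d) ((2 * k : ℕ) : ℂ) _ :=
    (hasSum_chi_div_pow hk).congr_fun (fun n => (hterm _ n))
  have h₂ : LSeriesHasSum 1 ((2 * k : ℕ) : ℂ) _ :=
    (Complex.hasSum_ofReal.mpr (hasSum_zeta_nat hk)).congr_fun (fun n => by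
      rw [hterm]; simp)
  have h := (h₁.convolution h₂).mul_left (3 * √3 * Complex.I)
  rw [← hasSum_nat_add_iff' 1] at h
  convert! h using 1
  · ext m
    rw [hterm, S_eq_convolution]
    push_cast
    ring
  · simp

lemma integral_rpow_mul_exp_neg_div {c s : ℝ} (hc : 0 < c) (hs : 0 < s) :
    ∫ h in Set.Ioi (0 : ℝ), h ^ (-s - 1) * Real.exp (-c / h) = (1 / c) ^ s * Real.Gamma s := by
  rw [← Real.integral_rpow_mul_exp_neg_mul_Ioi hs hc,
    ← integral_comp_rpow_Ioi _ (by norm_num : (-1 : ℝ) ≠ 0)]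
  refine setIntegral_congr_fun measurableSet_Ioi fun h (hh : 0 < h) => ?_
  simp only [abs_neg, abs_one, one_mul, smul_eq_mul]
  rw [← Real.rpow_mul hh.le, ← mul_assoc, ← Real.rpow_add hh, Real.rpow_neg_one, div_inv_eq_mul]
  ring_nf

lemma integrableOn_rpow_mul_exp_neg_div {c s : ℝ} (hc : 0 < c) (hs : 0 < s) :
    IntegrableOn (fun h : ℝ => h ^ (-s - 1) * Real.exp (-c / h)) (Set.Ioi 0) := by
  refine not_imp_comm.mp integral_undef ?_
  rw [integral_rpow_mul_exp_neg_div hc hs]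
  have := Real.Gamma_pos_of_pos hs
  positivity

lemma norm_S_le (m : ℕ) : ‖S m‖ ≤ 3 * √3 * m := by
  rw [S, norm_mul]
  gcongr
  · simp [abs_of_nonneg]
  · calc ‖∑ d ∈ m.divisors, (chi d : ℂ) / d‖ ≤ ∑ d ∈ m.divisors, (1 : ℝ) := by
          refine norm_sum_le_of_le _ fun d hd => ?_
          have : (1 : ℝ) ≤ d := by exact_mod_cast Nat.pos_of_mem_divisors hd
          rw [norm_div, Complex.norm_natCast]
          exact div_le_one_of_le₀ ((norm_chi_le_one _).trans this) (by positivity)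
      _ ≤ m := by
          simpa using Nat.card_divisors_le_self m

lemma summable_S_mul_exp {h : ℝ} (hh : 0 < h) :
    Summable (fun m : ℕ => S (m + 1) * Complex.exp (-(4 * π ^ 2 * (m + 1)) / (3 * h))) := by
  set r : ℝ := Real.exp (-(4 * π ^ 2) / (3 * h))
  have hr : ‖r‖ < 1 := by
    rw [Real.norm_eq_abs, Real.abs_exp, Real.exp_lt_one_iff, neg_div]
    have : 0 < 4 * π ^ 2 / (3 * h) := by positivity
    linarith
  have hsum := (summable_nat_add_iff 1).mpr
    ((summable_pow_mul_geometric_of_norm_lt_one 1 hr).mul_left (3 * √3))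
  refine Summable.of_norm_bounded hsum fun m => ?_
  have hexp : ‖Complex.exp (-(4 * π ^ 2 * (m + 1)) / (3 * h))‖ = r ^ (m + 1) := by
    rw [show (-(4 * π ^ 2 * (m + 1)) / (3 * h) : ℂ) =
      ((((m + 1 : ℕ) : ℝ) * (-(4 * π ^ 2) / (3 * h)) : ℝ) : ℂ) by push_cast; ring,
      Complex.norm_exp_ofReal, Real.exp_nat_mul]
  rw [norm_mul, hexp, pow_one, ← mul_assoc]
  gcongr
  exact norm_S_le _

lemma hasSum_integral_S_mul_exp {n : ℕ} (hn : 1 ≤ n) :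
    HasSum (fun m : ℕ => S (m + 1) * ((1 / (4 * π ^ 2 * (m + 1) / 3)) ^ (2 * n) *
        ((2 * n - 1).factorial : ℂ)))
      (∫ h in Set.Ioi (0 : ℝ), (h : ℂ) ^ (-(2 * (n : ℤ)) - 1) *
        ∑' m : ℕ, S (m + 1) * Complex.exp (-(4 * π ^ 2 * (m + 1)) / (3 * h))) := by
  set c : ℕ → ℝ := fun m => 4 * π ^ 2 * (m + 1) / 3
  have hc (m : ℕ) : 0 < c m := by positivity
  set s : ℝ := ((2 * n : ℕ) : ℝ)
  have hs : 0 < s := by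
    exact Nat.cast_pos.mpr (by omega)
  set g : ℕ → ℝ → ℝ := fun m h => h ^ (-s - 1) * Real.exp (-c m / h)
  have hg (m : ℕ) {h : ℝ} (hh : 0 < h) : (h : ℂ) ^ (-(2 * (n : ℤ)) - 1) *
      (S (m + 1) * Complex.exp (-(4 * π ^ 2 * (m + 1)) / (3 * h))) = S (m + 1) * (g m h : ℂ) := by
    have hpow : h ^ (-s - 1) = h ^ (-(2 * (n : ℤ)) - 1) := by
      rw [← Real.rpow_intCast]
      push_cast [s]
      rfl
    have hexp : (-(4 * π ^ 2 * (m + 1)) / (3 * h) : ℂ) = ((-c m / h : ℝ) : ℂ) := by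
      push_cast [c]
      field_simp
    rw [hexp]
    simp only [g, hpow]
    push_cast
    ring
  have hgamma : Real.Gamma s = (2 * n - 1).factorial := by
    rw [← Real.Gamma_nat_eq_factorial]
    congr 1
    rw [Nat.cast_sub (by omega)]
    simp [s]
  have hint (m : ℕ) : ∫ h in Set.Ioi (0 : ℝ), g m h =
      (1 / c m) ^ (2 * n) * ((2 * n - 1).factorial : ℝ) := by
    rw [integral_rpow_mul_exp_neg_div (hc m) hs, hgamma, Real.rpow_natCast]
  have hsum := hasSum_integral_of_summable_integral_norm
    (μ := volume.restrict (Set.Ioi (0 : ℝ))) (F := fun m h => S (m + 1) * (g m h : ℂ))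
    (fun m => (integrableOn_rpow_mul_exp_neg_div (hc m) hs).ofReal.const_mul _) (by
      have hnorm (m : ℕ) : ∫ h in Set.Ioi (0 : ℝ), ‖S (m + 1) * (g m h : ℂ)‖ =
          (1 / (4 * π ^ 2 / 3)) ^ (2 * n) * ((2 * n - 1).factorial : ℝ) *
            ‖S (m + 1) / ((m : ℂ) + 1) ^ (2 * n)‖ := by
        have : ∫ h in Set.Ioi (0 : ℝ), ‖S (m + 1) * (g m h : ℂ)‖ =
            ∫ h in Set.Ioi (0 : ℝ), ‖S (m + 1)‖ * g m h := by
          refine setIntegral_congr_fun measurableSet_Ioi fun h (hh : 0 < h) => ?_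
          have : 0 ≤ g m h := by positivity
          simp only [norm_mul, Complex.norm_real, Real.norm_eq_abs, abs_of_nonneg this]
        rw [this, integral_const_mul, hint, norm_div, norm_pow,
          show ((m : ℂ) + 1) = ((m + 1 : ℕ) : ℂ) by push_cast; rfl, Complex.norm_natCast]
        rw [show 1 / c m = 1 / (4 * π ^ 2 / 3) / ((m + 1 : ℕ) : ℝ) by
          push_cast [c]
          field_simp, div_pow (1 / (4 * π ^ 2 / 3))]
        ring
      simp_rw [hnorm]
      exact (hasSum_S_div_pow (by omega : n ≠ 0)).summable.norm.mul_left _)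
  convert! hsum using 1
  · ext m
    rw [integral_const_mul, integral_complex_ofReal, hint]
    push_cast [c]
    rfl
  · refine setIntegral_congr_fun measurableSet_Ioi fun h (hh : 0 < h) => ?_
    simp only [← tsum_mul_left, hg _ hh]

theorem stmt2 (n : ℕ) (hn : 1 ≤ n) :
    (∀ h : ℝ, 0 < h →
      Summable (fun m : ℕ => S (m + 1) * Complex.exp (-(4 * π ^ 2 * (m + 1)) / (3 * h)))) ∧
    a n = ((-1 : ℂ) ^ n / (π * Complex.I)) *
      ∫ h in Set.Ioi (0 : ℝ), (h : ℂ) ^ (-(2 * (n : ℤ)) - 1) *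
        ∑' m : ℕ, S (m + 1) * Complex.exp (-(4 * π ^ 2 * (m + 1)) / (3 * h)) := by
  refine ⟨fun h hh => summable_S_mul_exp hh, ?_⟩
  have hπ : (π : ℂ) ≠ 0 := by exact_mod_cast Real.pi_ne_zero
  have h := (hasSum_S_div_pow (by omega : n ≠ 0)).mul_left
    ((1 / (4 * (π : ℂ) ^ 2 / 3)) ^ (2 * n) * ((2 * n - 1).factorial : ℂ))
  have hfun : (fun m : ℕ => (1 / (4 * (π : ℂ) ^ 2 / 3)) ^ (2 * n) * ((2 * n - 1).factorial : ℂ) *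
      (S (m + 1) / ((m : ℂ) + 1) ^ (2 * n))) = fun m : ℕ => S (m + 1) *
        ((1 / (4 * π ^ 2 * (m + 1) / 3)) ^ (2 * n) * ((2 * n - 1).factorial : ℂ)) := by
    ext m
    have : (m : ℂ) + 1 ≠ 0 := by exact_mod_cast Nat.succ_ne_zero m
    rw [show 1 / (4 * (π : ℂ) ^ 2 * (m + 1) / 3) = 1 / (4 * (π : ℂ) ^ 2 / 3) / (m + 1) by
      field_simp, div_pow (1 / (4 * (π : ℂ) ^ 2 / 3))]
    ring
  rw [hfun] at h
  rw [(hasSum_integral_S_mul_exp hn).unique h, a]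
  obtain ⟨k, rfl⟩ := Nat.exists_eq_add_of_le' hn
  have hs : (√3 : ℂ) ≠ 0 := by exact_mod_cast (by positivity : √3 ≠ 0)
  rw [show 2 * (k + 1) - 1 = 2 * k + 1 by omega, Nat.add_sub_cancel,
    show (2 * (k + 1)).factorial = (2 * (k + 1)) * (2 * k + 1).factorial from
      Nat.factorial_succ (2 * k + 1)]
  have hf : ((2 * k + 1).factorial : ℂ) ≠ 0 := by exact_mod_cast Nat.factorial_ne_zero _
  have hf' : ((2 * (k + 1) + 1).factorial : ℂ) ≠ 0 := by exact_mod_cast Nat.factorial_ne_zero _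
  have hk : (k : ℂ) + 1 ≠ 0 := by exact_mod_cast Nat.succ_ne_zero k
  have h4 : (4 : ℂ) ^ (2 * (k + 1)) = 2 ^ (2 * k + 1) * 2 ^ (2 * (k + 1) + 1) := by
    rw [show (4 : ℂ) = 2 ^ 2 by norm_num, ← pow_mul, ← pow_add]
    congr 1
    ring
  have hsign : (-1 : ℂ) ^ (k * 3) = (-1) ^ k := by rw [mul_comm, pow_mul]; norm_num
  simp only [div_pow, one_div, mul_pow, inv_div, h4]
  push_cast
  field_simp
  ring_nf
  rw [hsign]
end
end

section
/- The normalized weak- and strong-coupling Stokes constants of local ℙ² are related by an arithmetic twist: for every integer n ≥ 1, writing n = 3^v · m with v = v₃(n) the 3-adic valuation of n and 3 ∤ m, one has Σ_{d ∣ n} χ(d)/d = 3^v · χ(m) · Σ_{d ∣ n} χ(d)·d/n. -/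
noncomputable section

/-- The normalized weak-coupling Stokes constants `s(n) = Σ_{d∣n} χ(d)/d`. -/
def sQ (n : ℕ) : ℚ := ∑ d ∈ n.divisors, (chi d : ℚ) / d

/-- The normalized strong-coupling Stokes constants `r(n) = Σ_{d∣n} χ(d)·d/n`. -/
def rQ (n : ℕ) : ℚ := ∑ d ∈ n.divisors, (chi d : ℚ) * d / n

theorem chi_eq_zero_of_three_dvd {d : ℕ} (h : 3 ∣ d) : chi d = 0 := by
  unfold chi
  rw [if_neg (by omega), if_neg (by omega)]

theorem chi_mul (a b : ℤ) : chi (a * b) = chi a * chi b := by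
  have ha : a % 3 = 0 ∨ a % 3 = 1 ∨ a % 3 = 2 := by omega
  have hb : b % 3 = 0 ∨ b % 3 = 1 ∨ b % 3 = 2 := by omega
  rcases ha with ha | ha | ha <;> rcases hb with hb | hb | hb <;>
    simp [chi, Int.mul_emod, ha, hb]

theorem chi_mul_self {d : ℕ} (h : ¬ 3 ∣ d) : chi d * chi d = 1 := by
  have hd : (d : ℤ) % 3 = 1 ∨ (d : ℤ) % 3 = 2 := by omega
  rcases hd with hd | hd <;> simp [chi, hd]

/-- A divisor sum weighted by `chi` only sees the divisors of the prime-to-3 part. -/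
theorem sum_divisors_three_pow_mul {v m : ℕ} (hm : m ≠ 0) (f : ℕ → ℚ)
    (hf : ∀ d, 3 ∣ d → f d = 0) :
    ∑ d ∈ (3 ^ v * m).divisors, f d = ∑ d ∈ m.divisors, f d := by
  refine (Finset.sum_subset
    (Nat.divisors_subset_of_dvd (by positivity) (Dvd.intro_left _ rfl)) ?_).symm
  intro d hd hdm
  refine hf d ?_
  by_contra h
  have hcop : Nat.Coprime d (3 ^ v) :=
    (((Nat.Prime.coprime_iff_not_dvd Nat.prime_three).2 h).symm).pow_right v
  exact hdm (Nat.mem_divisors.2 ⟨hcop.dvd_of_dvd_mul_left (Nat.dvd_of_mem_divisors hd), hm⟩)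

theorem stmt5 (n : ℕ) (hn : 1 ≤ n) (v m : ℕ)
    (hv : v = padicValNat 3 n) (hnm : n = 3 ^ v * m) (hm : ¬ (3 ∣ m)) :
    sQ n = 3 ^ v * (chi m : ℚ) * rQ n := by
  have hm0 : m ≠ 0 := by rintro rfl; simp at hm
  unfold sQ rQ
  rw [hnm, sum_divisors_three_pow_mul hm0 _ fun d hd => by simp [chi_eq_zero_of_three_dvd hd],
    sum_divisors_three_pow_mul hm0 _ fun d hd => by simp [chi_eq_zero_of_three_dvd hd],
    ← Nat.sum_div_divisors, Finset.mul_sum]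
  refine Finset.sum_congr rfl fun d hd => ?_
  obtain ⟨e, rfl⟩ := Nat.dvd_of_mem_divisors hd
  have hd0 : d ≠ 0 := left_ne_zero_of_mul hm0
  have he0 : e ≠ 0 := right_ne_zero_of_mul hm0
  have hsq : (chi d : ℚ) * chi d = 1 :=
    mod_cast chi_mul_self fun h => hm (h.mul_right e)
  rw [Nat.mul_div_cancel_left e (Nat.pos_of_ne_zero hd0)]
  push_cast [chi_mul]
  field_simp
  linear_combination -(chi e : ℚ) * hsq
end
end

section
/- The normalized weak- and strong-coupling Stokes constants of local ℙ² satisfy the character-twist identity: for every integer n ≥ 1, χ₁(n) · Σ_{d ∣ n} χ(d)/d = χ(n) · Σ_{d ∣ n} χ(d)·d/n, where χ₁ is the principal Dirichlet character modulo 3 (χ₁(n) = 1 if 3 ∤ n and χ₁(n) = 0 if 3 ∣ n). -/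
noncomputable section

/-- The principal Dirichlet character modulo 3. -/
def chi1 (n : ℤ) : ℤ := if (3 : ℤ) ∣ n then 0 else 1

theorem chi1_mul_mul_chi (d e : ℤ) : chi1 (d * e) * chi d = chi (d * e) * chi e := by
  have hd : d % 3 = 0 ∨ d % 3 = 1 ∨ d % 3 = 2 := by omega
  have he : e % 3 = 0 ∨ e % 3 = 1 ∨ e % 3 = 2 := by omega
  rcases hd with hd | hd | hd <;> rcases he with he | he | he <;>
    simp [chi, chi1, Int.dvd_iff_emod_eq_zero, Int.mul_emod, hd, he]

theorem stmt6 (n : ℕ) (hn : 1 ≤ n) :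
    (chi1 n : ℚ) * sQ n = (chi n : ℚ) * rQ n := by
  unfold sQ rQ
  rw [← Nat.sum_div_divisors n fun d : ℕ => (chi d : ℚ) * d / n, Finset.mul_sum, Finset.mul_sum]
  refine Finset.sum_congr rfl fun d hd => ?_
  obtain ⟨e, rfl⟩ := Nat.dvd_of_mem_divisors hd
  have hd0 : d ≠ 0 := by rintro rfl; simp at hn
  have he0 : e ≠ 0 := by rintro rfl; simp at hn
  rw [Nat.mul_div_cancel_left e (Nat.pos_of_ne_zero hd0)]
  have key : (chi1 (d * e : ℕ) : ℚ) * chi d = chi (d * e : ℕ) * chi e := by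
    exact_mod_cast chi1_mul_mul_chi d e
  have hdq : (d : ℚ) ≠ 0 := by exact_mod_cast hd0
  have heq : (e : ℚ) ≠ 0 := by exact_mod_cast he0
  rw [← mul_div_assoc, key, Nat.cast_mul (α := ℚ) d e]
  field_simp
end
end

section
/- The weak- and strong-coupling L-functions of local ℙ² are obtained from each other by a character twist: for every complex s with Re(s) > 1, (i) Σ_{n=1}^∞ (Σ_{d ∣ n} χ(d)/d) · n^{-s} = (1 − 3^{-s})^{-1} · Σ_{n=1}^∞ χ(n) · (Σ_{d ∣ n} χ(d)·d/n) · n^{-s}, and (ii) Σ_{n=1}^∞ (Σ_{d ∣ n} χ(d)·d/n) · n^{-s} = (1 − 3^{-(s+1)})^{-1} · Σ_{n=1}^∞ χ(n) · (Σ_{d ∣ n} χ(d)/d) · n^{-s}; all four series converge absolutely for Re(s) > 1. -/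
noncomputable section

open LSeries Complex
open scoped LSeries.notation

/-- `chi` as a Dirichlet character with complex values. -/
def chiChar : DirichletCharacter ℂ 3 :=
  (quadraticChar (ZMod 3)).ringHomComp (Int.castRingHom ℂ)

theorem chiChar_natCast (n : ℕ) : chiChar n = chi n := by
  have hn : (n : ZMod 3) = ((n % 3 : ℕ) : ZMod 3) := (ZMod.natCast_mod n 3).symm
  have h3 : n % 3 < 3 := Nat.mod_lt _ (by norm_num)
  have hz : ((n : ℤ) % 3) = ((n % 3 : ℕ) : ℤ) := by push_cast; rfl
  rw [hn, chi, hz]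
  rw [chiChar, MulChar.ringHomComp_apply, eq_intCast, Int.cast_inj]
  generalize n % 3 = m at h3
  interval_cases m <;> decide

theorem chiChar_mul_self : chiChar * chiChar = 1 := by
  rw [← sq]
  exact ((quadraticChar_isQuadratic (ZMod 3)).comp _).sq_eq_one

/-- Dividing the coefficients by `n` shifts the Dirichlet series by one. -/
theorem term_div_natCast (f : ℕ → ℂ) (s : ℂ) :
    term (fun n ↦ f n / n) s = term f (s + 1) := by
  ext n
  rcases eq_or_ne n 0 with rfl | hn
  · simp
  · rw [term_of_ne_zero hn, term_of_ne_zero hn, cpow_add _ _ (Nat.cast_ne_zero.mpr hn), cpow_one,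
      div_div, mul_comm]

theorem LSeriesHasSum_div_natCast {f : ℕ → ℂ} {s : ℂ} (hf : LSeriesSummable f (s + 1)) :
    LSeriesHasSum (fun n ↦ f n / n) s (L f (s + 1)) := by
  rw [LSeriesHasSum, term_div_natCast]
  exact hf.LSeriesHasSum

theorem LSeriesHasSum.hasSum_nat_succ {f : ℕ → ℂ} {s a : ℂ} (hf : LSeriesHasSum f s a) :
    HasSum (fun k : ℕ ↦ f (k + 1) * ((k + 1 : ℕ) : ℂ) ^ (-s)) a := by
  have h := (hasSum_nat_add_iff' 1).mpr hf
  simp only [Finset.sum_range_one, term_zero, sub_zero] at h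
  refine h.congr_fun fun k ↦ ?_
  rw [term_of_ne_zero k.succ_ne_zero, cpow_neg, div_eq_mul_inv]

theorem LSeries_trivChar_three {s : ℂ} (hs : 1 < s.re) :
    L ↗(1 : DirichletCharacter ℂ 3) s = (1 - (3 : ℂ) ^ (-s)) * L 1 s := by
  have hs1 : s ≠ 1 := by
    rintro rfl
    simp at hs
  rw [← DirichletCharacter.LFunction_eq_LSeries _ hs, LSeries_one_eq_riemannZeta hs]
  have h := DirichletCharacter.LFunctionTrivChar_eq_mul_riemannZeta (N := 3) hs1
  rwa [Nat.prime_three.primeFactors, Finset.prod_singleton] at h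

theorem one_sub_three_cpow_neg_ne_zero {s : ℂ} (hs : 1 < s.re) : 1 - (3 : ℂ) ^ (-s) ≠ 0 := by
  intro h
  have := DirichletCharacter.LSeries_ne_zero_of_one_lt_re (1 : DirichletCharacter ℂ 3) hs
  rw [LSeries_trivChar_three hs, h, zero_mul] at this
  exact this rfl

theorem convolution_chi_div_one : (fun n : ℕ ↦ chiChar n / n) ⍟ 1 = fun n ↦ (sQ n : ℂ) := by
  ext n
  simp only [convolution_def]
  rw [Nat.sum_divisorsAntidiagonal (fun i j ↦ chiChar i / i * (1 : ℕ → ℂ) j), sQ]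
  simp [chiChar_natCast]

theorem convolution_chi_one_div :
    (fun n : ℕ ↦ chiChar n) ⍟ (fun n ↦ (1 : ℕ → ℂ) n / n) = fun n ↦ (rQ n : ℂ) := by
  ext n
  simp only [convolution_def]
  rw [Nat.sum_divisorsAntidiagonal (fun i j ↦ chiChar i * ((1 : ℕ → ℂ) j / j)), rQ]
  push_cast
  refine Finset.sum_congr rfl fun d hd ↦ ?_
  have hdvd := Nat.dvd_of_mem_divisors hd
  have hd0 : (d : ℂ) ≠ 0 := Nat.cast_ne_zero.mpr (Nat.pos_of_mem_divisors hd).ne'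
  rw [chiChar_natCast, Nat.cast_div hdvd hd0, Pi.one_apply, one_div_div, mul_div_assoc]

/-- Twisting a convolution with `χ` by `χ` turns the factor `χ` into the trivial character. -/
theorem chi_mul_sQ : (fun n : ℕ ↦ (1 : DirichletCharacter ℂ 3) n / n) ⍟ (fun n : ℕ ↦ chiChar n) =
    fun n : ℕ ↦ (chi n : ℂ) * (sQ n : ℂ) := by
  have h := DirichletCharacter.mul_convolution_distrib chiChar (fun n : ℕ ↦ chiChar n / n) 1
  rw [convolution_chi_div_one, mul_one] at h
  simp only [← chiChar_mul_self, MulChar.mul_apply, ← chiChar_natCast, mul_div_assoc]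
  exact h

theorem chi_mul_rQ :
    (fun n : ℕ ↦ (1 : DirichletCharacter ℂ 3) n) ⍟ (fun n : ℕ ↦ chiChar n / n) =
    fun n : ℕ ↦ (chi n : ℂ) * (rQ n : ℂ) := by
  have h := DirichletCharacter.mul_convolution_distrib chiChar (fun n : ℕ ↦ chiChar n)
    (fun n ↦ (1 : ℕ → ℂ) n / n)
  rw [convolution_chi_one_div] at h
  simp only [← chiChar_mul_self, MulChar.mul_apply, ← chiChar_natCast]
  have hdiv : ((fun n : ℕ ↦ chiChar n) * fun n : ℕ ↦ (1 : ℕ → ℂ) n / n) =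
      fun n : ℕ ↦ chiChar n / n := by
    ext n
    simp [div_eq_mul_inv]
  rw [hdiv] at h
  exact h

theorem stmt7 (s : ℂ) (hs : 1 < s.re) :
    Summable (fun k : ℕ => (sQ (k + 1) : ℂ) * ((k + 1 : ℕ) : ℂ) ^ (-s)) ∧
    Summable (fun k : ℕ => (chi (k + 1) : ℂ) * (rQ (k + 1) : ℂ) * ((k + 1 : ℕ) : ℂ) ^ (-s)) ∧
    Summable (fun k : ℕ => (rQ (k + 1) : ℂ) * ((k + 1 : ℕ) : ℂ) ^ (-s)) ∧
    Summable (fun k : ℕ => (chi (k + 1) : ℂ) * (sQ (k + 1) : ℂ) * ((k + 1 : ℕ) : ℂ) ^ (-s)) ∧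
    (∑' k : ℕ, (sQ (k + 1) : ℂ) * ((k + 1 : ℕ) : ℂ) ^ (-s))
      = (1 - (3 : ℂ) ^ (-s))⁻¹ *
        ∑' k : ℕ, (chi (k + 1) : ℂ) * (rQ (k + 1) : ℂ) * ((k + 1 : ℕ) : ℂ) ^ (-s) ∧
    (∑' k : ℕ, (rQ (k + 1) : ℂ) * ((k + 1 : ℕ) : ℂ) ^ (-s))
      = (1 - (3 : ℂ) ^ (-(s + 1)))⁻¹ *
        ∑' k : ℕ, (chi (k + 1) : ℂ) * (sQ (k + 1) : ℂ) * ((k + 1 : ℕ) : ℂ) ^ (-s) := by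
  have hs' : 1 < (s + 1).re := by
    rw [add_re, one_re]
    linarith
  have hone {t : ℂ} (ht : 1 < t.re) : LSeriesSummable 1 t := LSeriesSummable_one_iff.mpr ht
  have hchar {t : ℂ} (ht : 1 < t.re) (ψ : DirichletCharacter ℂ 3) : LSeriesSummable ↗ψ t :=
    DirichletCharacter.LSeriesSummable_of_one_lt_re ψ ht
  have hS := (LSeriesHasSum_div_natCast (hchar hs' chiChar)).convolution (hone hs).LSeriesHasSum
  have hR := (hchar hs chiChar).LSeriesHasSum.convolution (LSeriesHasSum_div_natCast (hone hs'))
  have hχS := (LSeriesHasSum_div_natCast (hchar hs' 1)).convolution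
    (hchar hs chiChar).LSeriesHasSum
  have hχR := (hchar hs 1).LSeriesHasSum.convolution
    (LSeriesHasSum_div_natCast (hchar hs' chiChar))
  rw [convolution_chi_div_one] at hS
  rw [convolution_chi_one_div] at hR
  rw [chi_mul_sQ, LSeries_trivChar_three hs'] at hχS
  rw [chi_mul_rQ, LSeries_trivChar_three hs] at hχR
  replace hS := hS.hasSum_nat_succ
  replace hR := hR.hasSum_nat_succ
  replace hχS := hχS.hasSum_nat_succ
  replace hχR := hχR.hasSum_nat_succ
  simp only [Nat.cast_add_one (R := ℤ)] at hχS hχR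
  refine ⟨hS.summable, hχR.summable, hR.summable, hχS.summable, ?_, ?_⟩
  · rw [hS.tsum_eq, hχR.tsum_eq]
    have := one_sub_three_cpow_neg_ne_zero hs
    field_simp
  · rw [hR.tsum_eq, hχS.tsum_eq]
    have := one_sub_three_cpow_neg_ne_zero hs'
    field_simp
end
end

section
/- The Borel–Laplace sum along the positive real axis of the weak-coupling perturbative series of the logarithm of the spectral trace of local ℙ² is an explicit sum of exponential integrals: for every ħ ∈ ℂ with Re(ħ) > 0, ∫_0^∞ e^{-ζ/ħ} · [(1/(2πi)) · Σ_{m ∈ ℤ, m ≠ 0} S_m/((4π²/3)·i·m − ζ)] dζ = − Σ_{m ∈ ℤ, m ≠ 0} S_m · 𝐞₁(−2πm/(3ħ)), where the integral is over real ζ ≥ 0 and all sums converge. -/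
open scoped Real
open MeasureTheory

noncomputable section

/-- The weak-coupling Stokes constants `S_m = 3√3 i Σ_{d∣|m|} χ(d)/d` for `m ∈ ℤ`. -/
def SZ (m : ℤ) : ℂ :=
  3 * Real.sqrt 3 * Complex.I * ∑ d ∈ m.natAbs.divisors, (chi d : ℂ) / d

/-- The exponential integral `𝐞₁(y) = (1/(2πi)) ∫₀^∞ e^{−2πt}/(t + i y) dt`. -/
def e1 (y : ℂ) : ℂ :=
  (1 / (2 * π * Complex.I)) *
    ∫ t in Set.Ioi (0 : ℝ), Complex.exp (-2 * π * t) / (t + Complex.I * y)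

lemma SZ_neg (m : ℤ) : SZ (-m) = SZ m := by
  simp [SZ]

lemma norm_SZ_le (n : ℕ) : ‖SZ n‖ ≤ 3 * √3 * (1 + Real.log n) := by
  have hsum : ‖∑ d ∈ n.divisors, (chi d : ℂ) / d‖ ≤ 1 + Real.log n := by
    calc ‖∑ d ∈ n.divisors, (chi d : ℂ) / d‖
        ≤ ∑ d ∈ n.divisors, (d : ℝ)⁻¹ := by
          refine norm_sum_le_of_le _ fun d _ => ?_
          rw [norm_div, Complex.norm_natCast, div_eq_mul_inv]
          exact mul_le_of_le_one_left (by positivity) (norm_chi_le_one d)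
      _ ≤ ∑ d ∈ Finset.Icc 1 n, (d : ℝ)⁻¹ := by
          refine Finset.sum_le_sum_of_subset_of_nonneg (fun d hd => ?_) fun d _ _ => by positivity
          exact Finset.mem_Icc.2 ⟨Nat.pos_of_mem_divisors hd, Nat.divisor_le hd⟩
      _ = (harmonic n : ℝ) := by
          rw [harmonic_eq_sum_Icc]
          push_cast
          rfl
      _ ≤ 1 + Real.log n := harmonic_le_one_add_log n
  have h3 : ‖(3 * Real.sqrt 3 * Complex.I : ℂ)‖ = 3 * √3 := by
    simp [abs_of_nonneg (Real.sqrt_nonneg 3)]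
  unfold SZ
  rw [norm_mul, h3, Int.natAbs_natCast]
  gcongr

lemma summable_norm_SZ_div_sq :
    Summable fun n : ℕ => ‖SZ ((n : ℤ) + 1)‖ / ((n : ℝ) + 1) ^ 2 := by
  have hs : Summable fun n : ℕ => ‖SZ (n : ℤ)‖ / (n : ℝ) ^ 2 := by
    have h : Summable fun n : ℕ => 3 * √3 * 3 * (1 / (n : ℝ) ^ (3 / 2 : ℝ)) :=
      (Real.summable_one_div_nat_rpow.2 (by norm_num)).mul_left _
    refine Summable.of_nonneg_of_le (fun n => by positivity) (fun n => ?_) h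
    rcases Nat.eq_zero_or_pos n with rfl | hn
    · simp
    have hn1 : (1 : ℝ) ≤ n := by exact_mod_cast hn
    have hlog : 1 + Real.log n ≤ 3 * (n : ℝ) ^ (1 / 2 : ℝ) := by
      have h1 := Real.log_le_rpow_div (x := n) (by positivity) (ε := 1 / 2) (by norm_num)
      have h2 : (1 : ℝ) ≤ (n : ℝ) ^ (1 / 2 : ℝ) := Real.one_le_rpow hn1 (by norm_num)
      linarith
    have hpow : (n : ℝ) ^ 2 = (n : ℝ) ^ (1 / 2 : ℝ) * (n : ℝ) ^ (3 / 2 : ℝ) := by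
      rw [← Real.rpow_add (by positivity), ← Real.rpow_natCast]
      norm_num
    calc ‖SZ (n : ℤ)‖ / (n : ℝ) ^ 2 ≤ 3 * √3 * (3 * (n : ℝ) ^ (1 / 2 : ℝ)) / (n : ℝ) ^ 2 := by
          gcongr
          exact (norm_SZ_le n).trans (by gcongr)
      _ = 3 * √3 * 3 * (1 / (n : ℝ) ^ (3 / 2 : ℝ)) := by
          rw [hpow]
          field_simp
  simpa using (summable_nat_add_iff 1).2 hs

lemma sum_Icc_neg_erase_zero (f : ℤ → ℂ) (N : ℕ) :
    ∑ m ∈ (Finset.Icc (-(N : ℤ)) (N : ℤ)).erase 0, f m =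
      ∑ n ∈ Finset.range N, (f ((n : ℤ) + 1) + f (-((n : ℤ) + 1))) := by
  induction N with
  | zero => simp
  | succ N ih =>
    have hset : (Finset.Icc (-((N + 1 : ℕ) : ℤ)) ((N + 1 : ℕ) : ℤ)).erase 0 =
        insert ((N : ℤ) + 1) (insert (-((N : ℤ) + 1))
          ((Finset.Icc (-(N : ℤ)) (N : ℤ)).erase 0)) := by
      ext x
      simp only [Finset.mem_erase, Finset.mem_Icc, Finset.mem_insert]
      push_cast
      omega
    rw [hset, Finset.sum_insert, Finset.sum_insert, ih, Finset.sum_range_succ]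
    · ring
    · simp only [Finset.mem_erase, Finset.mem_Icc]
      omega
    · simp only [Finset.mem_erase, Finset.mem_Icc, Finset.mem_insert]
      omega

lemma ofReal_sub_I_mul_ne_zero (t : ℝ) {z : ℂ} (hz : z.re ≠ 0) : (t : ℂ) - Complex.I * z ≠ 0 := by
  intro h
  apply hz
  simpa using congrArg Complex.im h

lemma abs_re_le_norm_ofReal_sub_I_mul (t : ℝ) (z : ℂ) : |z.re| ≤ ‖(t : ℂ) - Complex.I * z‖ := by
  simpa using Complex.abs_im_le_norm ((t : ℂ) - Complex.I * z)

lemma continuous_inv_ofReal_sub_I_mul {z : ℂ} (hz : z.re ≠ 0) :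
    Continuous fun t : ℝ => ((t : ℂ) - Complex.I * z)⁻¹ :=
  Continuous.inv₀ (by fun_prop) fun t => ofReal_sub_I_mul_ne_zero t hz

lemma norm_exp_neg_ofReal_mul (t : ℝ) (p : ℂ) :
    ‖Complex.exp (-t * p)‖ = Real.exp (-p.re * t) := by
  rw [Complex.norm_exp]
  congr 1
  simp [mul_comm]

lemma integrableOn_exp_mul_inv {p z : ℂ} (hp : 0 < p.re) (hz : z.re ≠ 0) :
    IntegrableOn (fun t : ℝ => Complex.exp (-t * p) * ((t : ℂ) - Complex.I * z)⁻¹)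
      (Set.Ioi 0) := by
  have hc := continuous_inv_ofReal_sub_I_mul hz
  refine Integrable.mono' ((exp_neg_integrableOn_Ioi 0 hp).mul_const |z.re|⁻¹)
    (Continuous.aestronglyMeasurable (by fun_prop)) (Filter.Eventually.of_forall fun t => ?_)
  rw [norm_mul, norm_exp_neg_ofReal_mul, norm_inv]
  have := abs_re_le_norm_ofReal_sub_I_mul t z
  have := abs_pos.2 hz
  gcongr

lemma setOf_half_re_lt_mem_nhds {p : ℂ} (hp : 0 < p.re) : {q : ℂ | p.re / 2 < q.re} ∈ nhds p :=
  (isOpen_lt continuous_const Complex.continuous_re).mem_nhds (by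
    show p.re / 2 < p.re
    linarith)

lemma differentiableAt_laplace {b : ℝ} (hb : b ≠ 0) {p : ℂ} (hp : 0 < p.re) :
    DifferentiableAt ℂ (fun p : ℂ => ∫ t in Set.Ioi (0 : ℝ),
      Complex.exp (-t * p) * ((t : ℂ) - Complex.I * b)⁻¹) p := by
  have hc := continuous_inv_ofReal_sub_I_mul (z := b) (by simpa using hb)
  refine (hasDerivAt_integral_of_dominated_loc_of_deriv_le
    (μ := volume.restrict (Set.Ioi (0 : ℝ)))
    (F := fun (q : ℂ) (t : ℝ) => Complex.exp (-t * q) * ((t : ℂ) - Complex.I * b)⁻¹)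
    (F' := fun q t => Complex.exp (-t * q) * -(t : ℂ) * ((t : ℂ) - Complex.I * b)⁻¹)
    (bound := fun t => Real.exp (-(p.re / 2) * t))
    (setOf_half_re_lt_mem_nhds hp)
    (Filter.Eventually.of_forall fun q => Continuous.aestronglyMeasurable (by fun_prop))
    (integrableOn_exp_mul_inv hp (by simpa using hb))
    (Continuous.aestronglyMeasurable (by fun_prop)) ?_
    (exp_neg_integrableOn_Ioi 0 (by linarith)) ?_).2.differentiableAt
  · refine (ae_restrict_mem measurableSet_Ioi).mono fun t ht q hq => ?_
    have ht : 0 < t := ht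
    have hq : p.re / 2 < q.re := hq
    rw [mul_assoc, norm_mul, norm_exp_neg_ofReal_mul]
    have h1 : ‖-(t : ℂ) * ((t : ℂ) - Complex.I * b)⁻¹‖ ≤ 1 := by
      rw [norm_mul, norm_inv, norm_neg, ← div_eq_mul_inv]
      refine div_le_one_of_le₀ ?_ (norm_nonneg _)
      simpa using Complex.abs_re_le_norm ((t : ℂ) - Complex.I * b)
    refine (mul_le_of_le_one_right (Real.exp_pos _).le h1).trans ?_
    gcongr
  · refine Filter.Eventually.of_forall fun t q _ => ?_
    have h : HasDerivAt (fun q : ℂ => -(t : ℂ) * q) (-(t : ℂ)) q := by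
      simpa using (hasDerivAt_id q).const_mul (-(t : ℂ))
    exact h.cexp.mul_const _

lemma differentiableAt_integral_exp_mul_inv {c : ℝ} (hc : c ≠ 0) {p : ℂ} (hp : 0 < p.re) :
    DifferentiableAt ℂ (fun p : ℂ => ∫ t in Set.Ioi (0 : ℝ),
      Complex.exp (-t * (2 * π)) * ((t : ℂ) - Complex.I * (c * p))⁻¹) p := by
  have hre : ∀ q : ℂ, 0 < q.re → (c * q : ℂ).re ≠ 0 := fun q hq => by
    simpa using ⟨hc, hq.ne'⟩
  have hπ : 0 < (2 * π : ℂ).re := by simpa using Real.pi_pos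
  have hcont : ∀ q : ℂ, 0 < q.re →
      Continuous fun t : ℝ => ((t : ℂ) - Complex.I * (c * q))⁻¹ :=
    fun q hq => continuous_inv_ofReal_sub_I_mul (hre q hq)
  refine (hasDerivAt_integral_of_dominated_loc_of_deriv_le
    (μ := volume.restrict (Set.Ioi (0 : ℝ)))
    (F := fun (q : ℂ) (t : ℝ) =>
      Complex.exp (-t * (2 * π)) * ((t : ℂ) - Complex.I * (c * q))⁻¹)
    (F' := fun q t => Complex.exp (-t * (2 * π)) *
      ((Complex.I * c) * (((t : ℂ) - Complex.I * (c * q))⁻¹) ^ 2))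
    (bound := fun t => Real.exp (-(2 * π) * t) * (|c| * (|c| * (p.re / 2))⁻¹ ^ 2))
    (setOf_half_re_lt_mem_nhds hp)
    (Filter.mem_of_superset (setOf_half_re_lt_mem_nhds hp) fun q hq => ?_)
    (integrableOn_exp_mul_inv hπ (hre p hp))
    ?_ ?_
    ((exp_neg_integrableOn_Ioi 0 (by positivity)).mul_const _) ?_).2.differentiableAt
  · have hq : p.re / 2 < q.re := hq
    have := hcont q (by linarith)
    exact Continuous.aestronglyMeasurable (by fun_prop)
  · have := hcont p hp
    exact Continuous.aestronglyMeasurable (by fun_prop)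
  · refine Filter.Eventually.of_forall fun t q hq => ?_
    have hq : p.re / 2 < q.re := hq
    have h := abs_re_le_norm_ofReal_sub_I_mul t (c * q)
    have hq' : |(c * q : ℂ).re| = |c| * q.re := by
      simp [abs_mul, abs_of_pos (show 0 < q.re by linarith)]
    rw [hq'] at h
    have hc' := abs_pos.2 hc
    have h2 : |c| * (p.re / 2) ≤ ‖(t : ℂ) - Complex.I * (c * q)‖ :=
      le_trans (by gcongr) h
    rw [norm_mul, norm_exp_neg_ofReal_mul, norm_mul, norm_pow, norm_inv, norm_mul,
      Complex.norm_I, one_mul, Complex.norm_real, Real.norm_eq_abs]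
    have : (2 * π : ℂ).re = 2 * π := by simp
    rw [this]
    gcongr
  · refine Filter.Eventually.of_forall fun t q hq => ?_
    have hq : p.re / 2 < q.re := hq
    have h0 := ofReal_sub_I_mul_ne_zero t (hre q (by linarith))
    have h : HasDerivAt (fun q : ℂ => (t : ℂ) - Complex.I * (c * q)) (-(Complex.I * c)) q := by
      simpa using (((hasDerivAt_id q).const_mul (c : ℂ)).const_mul Complex.I).const_sub (t : ℂ)
    refine ((h.inv h0).const_mul (Complex.exp (-t * (2 * π)))).congr_deriv ?_
    rw [neg_neg, div_eq_mul_inv, inv_pow]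

/-- Rotation of the Laplace contour for a simple pole on the imaginary axis. -/
lemma laplace_inv_eq {b : ℝ} (hb : b ≠ 0) {p : ℂ} (hp : 0 < p.re) :
    ∫ t in Set.Ioi (0 : ℝ), Complex.exp (-t * p) * ((t : ℂ) - Complex.I * b)⁻¹ =
      ∫ t in Set.Ioi (0 : ℝ), Complex.exp (-t * (2 * π)) *
        ((t : ℂ) - Complex.I * ((b / (2 * π) : ℝ) * p))⁻¹ := by
  have hc : b / (2 * π) ≠ 0 := div_ne_zero hb (by positivity)
  have hopen : IsOpen {q : ℂ | 0 < q.re} := isOpen_lt continuous_const Complex.continuous_re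
  have hF : AnalyticOnNhd ℂ (fun p : ℂ => ∫ t in Set.Ioi (0 : ℝ),
      Complex.exp (-t * p) * ((t : ℂ) - Complex.I * b)⁻¹) {q : ℂ | 0 < q.re} :=
    DifferentiableOn.analyticOnNhd
      (fun q hq => (differentiableAt_laplace hb hq).differentiableWithinAt) hopen
  have hG : AnalyticOnNhd ℂ (fun p : ℂ => ∫ t in Set.Ioi (0 : ℝ),
      Complex.exp (-t * (2 * π)) * ((t : ℂ) - Complex.I * ((b / (2 * π) : ℝ) * p))⁻¹)
      {q : ℂ | 0 < q.re} :=
    DifferentiableOn.analyticOnNhd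
      (fun q hq => (differentiableAt_integral_exp_mul_inv hc hq).differentiableWithinAt) hopen
  have hreal : ∀ x : ℝ, 0 < x →
      ∫ t in Set.Ioi (0 : ℝ), Complex.exp (-t * (x : ℂ)) * ((t : ℂ) - Complex.I * b)⁻¹ =
      ∫ t in Set.Ioi (0 : ℝ), Complex.exp (-t * (2 * π)) *
        ((t : ℂ) - Complex.I * ((b / (2 * π) : ℝ) * (x : ℂ)))⁻¹ := by
    intro x hx
    have hk : 0 < 2 * π / x := by positivity
    have h := integral_comp_mul_left_Ioi'
      (fun t : ℝ => Complex.exp (-t * (x : ℂ)) * ((t : ℂ) - Complex.I * b)⁻¹) 0 hk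
    rw [mul_zero] at h
    rw [← h, ← integral_smul]
    congr 1
    ext t
    have hx' : (x : ℂ) ≠ 0 := by exact_mod_cast hx.ne'
    have hπ : (π : ℂ) ≠ 0 := by exact_mod_cast Real.pi_ne_zero
    have h1 := ofReal_sub_I_mul_ne_zero t (z := ((b / (2 * π) : ℝ) * (x : ℂ))) (by
      rw [← Complex.ofReal_mul, Complex.ofReal_re]
      exact mul_ne_zero hc hx.ne')
    have hden : ((2 * π / x * t : ℝ) : ℂ) - Complex.I * b =
        (2 * π / x) * ((t : ℂ) - Complex.I * ((b / (2 * π) : ℝ) * (x : ℂ))) := by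
      push_cast
      field_simp
    have hexp : -((2 * π / x * t : ℝ) : ℂ) * (x : ℂ) = -t * (2 * π) := by
      push_cast
      field_simp
    rw [hden, hexp, mul_inv, Complex.real_smul]
    push_cast
    field_simp
  refine hF.eqOn_of_preconnected_of_frequently_eq hG
    (convex_halfSpace_re_gt 0).isPreconnected (z₀ := 1) (by simp) ?_ hp
  have htend : Filter.Tendsto (fun x : ℝ => (x : ℂ)) (nhdsWithin 1 (Set.Ioi 1))
      (nhdsWithin (1 : ℂ) {1}ᶜ) := by
    refine tendsto_nhdsWithin_iff.2 ⟨?_, ?_⟩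
    · exact (Complex.continuous_ofReal.tendsto' 1 1 (by simp)).mono_left nhdsWithin_le_nhds
    · filter_upwards [self_mem_nhdsWithin] with x hx
      have hx : 1 < x := hx
      simpa using hx.ne'
  refine htend.frequently (Filter.Eventually.frequently ?_)
  filter_upwards [self_mem_nhdsWithin] with x hx
  have hx : 1 < x := hx
  exact hreal x (by linarith)

lemma integral_exp_neg_div_eq_e1 {ℏ : ℂ} (hℏ : 0 < ℏ.re) {m : ℤ} (hm : m ≠ 0) :
    IntegrableOn (fun ζ : ℝ => Complex.exp (-ζ / ℏ) *
      (1 / (2 * π * Complex.I) * (1 / ((4 * π ^ 2 / 3) * Complex.I * m - ζ)))) (Set.Ioi 0) ∧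
    ∫ ζ in Set.Ioi (0 : ℝ), Complex.exp (-ζ / ℏ) *
      (1 / (2 * π * Complex.I) * (1 / ((4 * π ^ 2 / 3) * Complex.I * m - ζ))) =
      -e1 (-(2 * π * m) / (3 * ℏ)) := by
  have hℏ0 : ℏ ≠ 0 := by
    rintro rfl
    simp at hℏ
  have hp : 0 < (ℏ⁻¹).re := by
    rw [Complex.inv_re]
    exact div_pos hℏ (Complex.normSq_pos.2 hℏ0)
  have hπ : (π : ℂ) ≠ 0 := by exact_mod_cast Real.pi_ne_zero
  set b : ℝ := 4 * π ^ 2 / 3 * m with hb_def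
  have hb : b ≠ 0 := by
    have : (m : ℝ) ≠ 0 := by exact_mod_cast hm
    positivity
  have hfun : (fun ζ : ℝ => Complex.exp (-ζ / ℏ) *
      (1 / (2 * π * Complex.I) * (1 / ((4 * π ^ 2 / 3) * Complex.I * m - ζ)))) =
      fun ζ : ℝ => (-(1 / (2 * π * Complex.I))) *
        (Complex.exp (-ζ * ℏ⁻¹) * ((ζ : ℂ) - Complex.I * b)⁻¹) := by
    ext ζ
    have h : (4 * π ^ 2 / 3) * Complex.I * m - ζ = -((ζ : ℂ) - Complex.I * b) := by
      rw [hb_def]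
      push_cast
      ring
    rw [h, one_div (-((ζ : ℂ) - Complex.I * b)), inv_neg, div_eq_mul_inv _ ℏ]
    ring
  rw [hfun]
  refine ⟨(integrableOn_exp_mul_inv hp (by simpa using hb)).const_mul _, ?_⟩
  rw [integral_const_mul, laplace_inv_eq hb hp, e1, neg_mul]
  congr 2
  refine integral_congr_ae (Filter.Eventually.of_forall fun t => ?_)
  simp only
  rw [div_eq_mul_inv]
  congr 2
  · ring_nf
  · rw [hb_def]
    push_cast
    field_simp
    ring

/-- The term at `ζ` contributed to the Borel transform by the pair of indices `±(n + 1)`. -/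
def borelPair (n : ℕ) (ζ : ℝ) : ℂ :=
  SZ ((n : ℤ) + 1) / ((4 * π ^ 2 / 3) * Complex.I * ((n : ℤ) + 1 : ℤ) - ζ) +
    SZ (-((n : ℤ) + 1)) / ((4 * π ^ 2 / 3) * Complex.I * (-((n : ℤ) + 1) : ℤ) - ζ)

lemma norm_borelPair_le (n : ℕ) {ζ : ℝ} (hζ : 0 ≤ ζ) :
    ‖borelPair n ζ‖ ≤ ζ * (‖SZ ((n : ℤ) + 1)‖ / ((n : ℝ) + 1) ^ 2) := by
  set x : ℝ := 4 * π ^ 2 / 3 * (n + 1) with hx_def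
  have hx : (n : ℝ) + 1 ≤ x / 2 := by
    have : (3 : ℝ) < π := Real.pi_gt_three
    rw [hx_def]
    nlinarith [mul_nonneg (show (0 : ℝ) ≤ π ^ 2 - 9 by nlinarith)
      (show (0 : ℝ) ≤ (n : ℝ) + 1 by positivity)]
  have hx0 : 0 < x := by positivity
  have hden : ∀ y : ℝ, y ≠ 0 → (y : ℂ) * Complex.I - ζ ≠ 0 := fun y hy h => by
    apply hy
    simpa using congrArg Complex.im h
  have h1 := hden x hx0.ne'
  have h2 := hden (-x) (neg_ne_zero.2 hx0.ne')
  have hsq : ((x ^ 2 + ζ ^ 2 : ℝ) : ℂ) ≠ 0 := by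
    exact_mod_cast (by positivity : x ^ 2 + ζ ^ 2 ≠ 0)
  have heq : borelPair n ζ = SZ ((n : ℤ) + 1) * ((-(2 * ζ) / (x ^ 2 + ζ ^ 2) : ℝ) : ℂ) := by
    have hplus : (4 * π ^ 2 / 3) * Complex.I * ((n : ℤ) + 1 : ℤ) - ζ = (x : ℂ) * Complex.I - ζ := by
      rw [hx_def]; push_cast; ring
    have hminus : (4 * π ^ 2 / 3) * Complex.I * (-((n : ℤ) + 1) : ℤ) - ζ =
        ((-x : ℝ) : ℂ) * Complex.I - ζ := by
      rw [hx_def]; push_cast; ring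
    have hprod : ((x : ℂ) * Complex.I - ζ) * (((-x : ℝ) : ℂ) * Complex.I - ζ) =
        ((x ^ 2 + ζ ^ 2 : ℝ) : ℂ) := by
      push_cast
      linear_combination (-(x : ℂ) ^ 2) * Complex.I_sq
    rw [borelPair, SZ_neg, hplus, hminus, div_add_div _ _ h1 h2, hprod, Complex.ofReal_div,
      ← mul_div_assoc]
    congr 1
    push_cast
    ring
  rw [heq, norm_mul, Complex.norm_real, Real.norm_eq_abs, abs_div, abs_neg,
    abs_of_nonneg (by positivity : 0 ≤ 2 * ζ), abs_of_pos (by positivity : 0 < x ^ 2 + ζ ^ 2)]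
  have h3 : 2 * ζ / (x ^ 2 + ζ ^ 2) ≤ ζ / ((n : ℝ) + 1) ^ 2 := by
    rw [div_le_div_iff₀ (by positivity) (by positivity)]
    have : 2 * ((n : ℝ) + 1) ^ 2 ≤ x ^ 2 + ζ ^ 2 := by
      nlinarith [sq_nonneg ζ, show (0 : ℝ) ≤ n by positivity]
    nlinarith
  calc ‖SZ ((n : ℤ) + 1)‖ * (2 * ζ / (x ^ 2 + ζ ^ 2))
      ≤ ‖SZ ((n : ℤ) + 1)‖ * (ζ / ((n : ℝ) + 1) ^ 2) := by gcongr
    _ = _ := by ring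

lemma hasSum_borelPair {ζ : ℝ} (hζ : 0 ≤ ζ) :
    HasSum (fun n => borelPair n ζ) (∑' n, borelPair n ζ) :=
  (Summable.of_norm_bounded (summable_norm_SZ_div_sq.mul_left ζ)
    fun n => norm_borelPair_le n hζ).hasSum

lemma integral_borelPair {ℏ : ℂ} (hℏ : 0 < ℏ.re) (n : ℕ) :
    IntegrableOn (fun ζ : ℝ => Complex.exp (-ζ / ℏ) *
      (1 / (2 * π * Complex.I) * borelPair n ζ)) (Set.Ioi 0) ∧
    ∫ ζ in Set.Ioi (0 : ℝ), Complex.exp (-ζ / ℏ) * (1 / (2 * π * Complex.I) * borelPair n ζ) =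
      -(SZ ((n : ℤ) + 1) * e1 (-(2 * π * ((n : ℤ) + 1 : ℤ)) / (3 * ℏ)) +
        SZ (-((n : ℤ) + 1)) * e1 (-(2 * π * (-((n : ℤ) + 1) : ℤ)) / (3 * ℏ))) := by
  obtain ⟨hi, he⟩ := integral_exp_neg_div_eq_e1 hℏ (m := (n : ℤ) + 1) (by omega)
  obtain ⟨hi', he'⟩ := integral_exp_neg_div_eq_e1 hℏ (m := -((n : ℤ) + 1)) (by omega)
  have hfun : (fun ζ : ℝ => Complex.exp (-ζ / ℏ) *
      (1 / (2 * π * Complex.I) * borelPair n ζ)) = fun ζ : ℝ =>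
      SZ ((n : ℤ) + 1) * (Complex.exp (-ζ / ℏ) * (1 / (2 * π * Complex.I) *
        (1 / ((4 * π ^ 2 / 3) * Complex.I * ((n : ℤ) + 1 : ℤ) - ζ)))) +
      SZ (-((n : ℤ) + 1)) * (Complex.exp (-ζ / ℏ) * (1 / (2 * π * Complex.I) *
        (1 / ((4 * π ^ 2 / 3) * Complex.I * (-((n : ℤ) + 1) : ℤ) - ζ)))) := by
    ext ζ
    rw [borelPair]
    ring
  rw [hfun]
  refine ⟨(hi.const_mul _).add (hi'.const_mul _), ?_⟩
  rw [integral_add (hi.const_mul _) (hi'.const_mul _), integral_const_mul, integral_const_mul,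
    he, he']
  ring

lemma integrableOn_id_mul_exp_neg {c : ℝ} (hc : 0 < c) :
    IntegrableOn (fun t : ℝ => t * Real.exp (-c * t)) (Set.Ioi 0) := by
  simpa using integrableOn_rpow_mul_exp_neg_mul_rpow (p := 1) (s := 1) (b := c)
    (by norm_num) one_pos hc

/-- The Borel–Laplace sum along the positive real axis of the weak-coupling perturbative
series is an explicit sum of exponential integrals; the bilateral sums over `m ≠ 0` are
understood as limits of symmetric partial sums. -/
theorem stmt10 (ℏ : ℂ) (hℏ : 0 < ℏ.re) :
    ∃ (B : ℝ → ℂ) (T : ℂ),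
      (∀ ζ : ℝ, 0 ≤ ζ →
        Filter.Tendsto
          (fun N : ℕ => ∑ m ∈ (Finset.Icc (-(N : ℤ)) (N : ℤ)).erase 0,
            SZ m / ((4 * π ^ 2 / 3) * Complex.I * m - ζ))
          Filter.atTop (nhds (B ζ))) ∧
      Filter.Tendsto
        (fun N : ℕ => ∑ m ∈ (Finset.Icc (-(N : ℤ)) (N : ℤ)).erase 0,
          SZ m * e1 (-(2 * π * m) / (3 * ℏ)))
        Filter.atTop (nhds T) ∧
      IntegrableOn
        (fun ζ : ℝ => Complex.exp (-ζ / ℏ) * (1 / (2 * π * Complex.I) * B ζ))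
        (Set.Ioi 0) ∧
      ∫ ζ in Set.Ioi (0 : ℝ), Complex.exp (-ζ / ℏ) * (1 / (2 * π * Complex.I) * B ζ)
        = -T := by
  have hp : 0 < (ℏ⁻¹).re := by
    rw [Complex.inv_re]
    refine div_pos hℏ (Complex.normSq_pos.2 ?_)
    rintro rfl
    simp at hℏ
  set K : ℝ := ‖(1 / (2 * π * Complex.I) : ℂ)‖
  set s : ℕ → ℝ := fun n => ‖SZ ((n : ℤ) + 1)‖ / ((n : ℝ) + 1) ^ 2
  have hs : Summable s := summable_norm_SZ_div_sq
  set bound : ℕ → ℝ → ℝ := fun n ζ => K * (ζ * Real.exp (-(ℏ⁻¹).re * ζ)) * s n with hbound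
  have hnorm : ∀ ζ : ℝ, ‖Complex.exp (-ζ / ℏ)‖ = Real.exp (-(ℏ⁻¹).re * ζ) := fun ζ => by
    rw [div_eq_mul_inv, norm_exp_neg_ofReal_mul]
  have hle : ∀ n, ∀ ζ : ℝ, 0 < ζ →
      ‖Complex.exp (-ζ / ℏ) * (1 / (2 * π * Complex.I) * borelPair n ζ)‖ ≤ bound n ζ := by
    intro n ζ hζ
    rw [norm_mul, norm_mul, hnorm]
    calc Real.exp (-(ℏ⁻¹).re * ζ) * (K * ‖borelPair n ζ‖)
        ≤ Real.exp (-(ℏ⁻¹).re * ζ) * (K * (ζ * s n)) := by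
          gcongr
          exact norm_borelPair_le n hζ.le
      _ = bound n ζ := by rw [hbound]; ring
  have hpos : ∀ᵐ ζ : ℝ ∂volume.restrict (Set.Ioi 0), 0 < ζ := ae_restrict_mem measurableSet_Ioi
  have hbsum : ∀ ζ, Summable fun n => bound n ζ := fun ζ => hs.mul_left _
  have hbint : IntegrableOn (fun ζ => ∑' n, bound n ζ) (Set.Ioi 0) := by
    simp only [hbound, tsum_mul_left]
    exact ((integrableOn_id_mul_exp_neg hp).const_mul K).mul_const _
  have hlim : ∀ᵐ ζ : ℝ ∂volume.restrict (Set.Ioi 0),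
      HasSum (fun n => Complex.exp (-ζ / ℏ) * (1 / (2 * π * Complex.I) * borelPair n ζ))
        (Complex.exp (-ζ / ℏ) * (1 / (2 * π * Complex.I) * ∑' n, borelPair n ζ)) :=
    hpos.mono fun ζ hζ => ((hasSum_borelPair hζ.le).mul_left _).mul_left _
  have hmeas := fun n => (integral_borelPair hℏ n).1.aestronglyMeasurable
  have hsum := hasSum_integral_of_dominated_convergence bound hmeas
    (fun n => hpos.mono fun ζ hζ => hle n ζ hζ) (Filter.Eventually.of_forall hbsum) hbint hlim
  simp only [fun n => (integral_borelPair hℏ n).2] at hsum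
  refine ⟨fun ζ => ∑' n, borelPair n ζ, -∫ ζ : ℝ in Set.Ioi (0 : ℝ),
    Complex.exp (-ζ / ℏ) * (1 / (2 * π * Complex.I) * ∑' n, borelPair n ζ), ?_, ?_, ?_, ?_⟩
  · intro ζ hζ
    simp only [sum_Icc_neg_erase_zero]
    exact (hasSum_borelPair hζ).tendsto_sum_nat
  · simp only [sum_Icc_neg_erase_zero]
    simpa using hsum.neg.tendsto_sum_nat
  · refine Integrable.mono' hbint ?_ ?_
    · refine aestronglyMeasurable_of_tendsto_ae Filter.atTop
        (f := fun N (ζ : ℝ) => ∑ n ∈ Finset.range N,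
          Complex.exp (-ζ / ℏ) * (1 / (2 * π * Complex.I) * borelPair n ζ)) (fun N => ?_)
        (hlim.mono fun ζ h => h.tendsto_sum_nat)
      exact Finset.aestronglyMeasurable_fun_sum _ fun n _ => hmeas n
    · filter_upwards [hpos, hlim] with ζ hζ h
      rw [← h.tsum_eq]
      exact tsum_of_norm_bounded (hbsum ζ).hasSum fun n => hle n ζ hζ
  · rw [neg_neg]
end
end

section
/- The generating function f₀ of the weak-coupling Stokes constants of local ℙ² is a holomorphic quantum modular function of weight zero for Γ₁(3): (i) f₀(y+1) = f₀(y) for every y in the upper half-plane ℍ (the cocycle of the generator T is trivial), and (ii) there exists a function h : ℂ → ℂ that is complex-differentiable on ℂ ∖ ℝ_{≤0} and satisfies h(y) = f₀(y/(3y+1)) − f₀(y) for every y ∈ ℍ (the cocycle of the generator γ₃ = [[1,0],[3,1]] extends holomorphically to the cut plane). -/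
open scoped Real

noncomputable section

/-- The strong-coupling Stokes constants of local ℙ². -/
def R (n : ℕ) : ℂ := 3 * ∑ d ∈ n.divisors, (chi d : ℂ) * d / n

/-- The generating function of the weak-coupling Stokes constants on the upper half-plane. -/
def f0 (y : ℂ) : ℂ := ∑' n : ℕ, S (n + 1) * Complex.exp (2 * π * Complex.I * (n + 1) * y)

/-- The generating function of the strong-coupling Stokes constants on the upper half-plane. -/
def finf (y : ℂ) : ℂ := ∑' n : ℕ, R (n + 1) * Complex.exp (2 * π * Complex.I * (n + 1) * y)

lemma exists_mul_add_le_norm {K : Set ℂ} (hK : IsCompact K) (hKs : K ⊆ Complex.slitPlane) :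
    ∃ c : ℝ, 0 < c ∧ ∀ z ∈ K, ∀ a b : ℝ, 0 ≤ a → 0 ≤ b → c * (a + b) ≤ ‖(a : ℂ) * z + b‖ := by
  have hpos : ∀ p ∈ K ×ˢ Set.Icc (0 : ℝ) 1, 0 < ‖(p.2 : ℂ) * p.1 + ((1 - p.2 : ℝ) : ℂ)‖ := by
    rintro ⟨z, t⟩ ⟨hz, ht0, ht1⟩
    rw [norm_pos_iff]
    apply Complex.slitPlane_ne_zero
    have := Complex.starConvex_one_slitPlane (hKs hz) (sub_nonneg.2 ht1) ht0 (by ring)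
    simpa [add_comm] using this
  obtain ⟨c, hc, hcK⟩ := (hK.prod isCompact_Icc).exists_forall_le' (a := 0)
    (f := fun p : ℂ × ℝ => ‖(p.2 : ℂ) * p.1 + ((1 - p.2 : ℝ) : ℂ)‖) (by fun_prop) hpos
  refine ⟨c, hc, fun z hz a b ha hb => ?_⟩
  rcases (add_nonneg ha hb).eq_or_lt with h | h
  · rw [← h]; simp
  have h1 := hcK (z, a / (a + b)) ⟨hz, by positivity, (div_le_one h).2 (by linarith)⟩
  have h2 : (a : ℂ) * z + b = ((a + b : ℝ) : ℂ) *
      (((a / (a + b) : ℝ) : ℂ) * z + ((1 - a / (a + b) : ℝ) : ℂ)) := by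
    have : (a : ℂ) + b ≠ 0 := by exact_mod_cast h.ne'
    push_cast
    field_simp
    ring
  rw [h2, norm_mul, Complex.norm_real, Real.norm_of_nonneg h.le, mul_comm]
  exact mul_le_mul_of_nonneg_left h1 h.le

/-- The double series obtained from the partial fraction expansion of `f0`. -/
def latticeTerm (p : ℕ × ℕ) (z : ℂ) : ℂ :=
  1 / (((p.2 : ℂ) + 1) * ((3 * p.1 + 1) * z + (p.2 + 1)) * ((3 * p.1 + 2) * z + (p.2 + 1)))

/-- The sum of `latticeTerm`, holomorphic on the slit plane. -/
def latticeSum (z : ℂ) : ℂ := ∑' p : ℕ × ℕ, latticeTerm p z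

/-- A summable majorant of `latticeTerm`, up to a constant, on compact subsets of the slit plane. -/
def latticeBound (p : ℕ × ℕ) : ℝ :=
  1 / ((p.1 : ℝ) + 1) ^ (3 / 2 : ℝ) * (1 / ((p.2 : ℝ) + 1) ^ (3 / 2 : ℝ))

lemma summable_latticeBound : Summable latticeBound := by
  have h : Summable fun n : ℕ => 1 / ((n : ℝ) + 1) ^ (3 / 2 : ℝ) := by
    have := (summable_nat_add_iff 1).2
      (Real.summable_one_div_nat_rpow (p := 3 / 2).2 (by norm_num))
    simpa using this
  exact h.mul_of_nonneg h (fun n => by positivity) (fun n => by positivity)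

lemma exists_norm_latticeTerm_le {K : Set ℂ} (hK : IsCompact K) (hKs : K ⊆ Complex.slitPlane) :
    ∃ C : ℝ, ∀ p, ∀ z ∈ K, ‖latticeTerm p z‖ ≤ C * latticeBound p := by
  obtain ⟨c, hc, h⟩ := exists_mul_add_le_norm hK hKs
  refine ⟨1 / c ^ 2, fun p z hz => ?_⟩
  obtain ⟨k, n⟩ := p
  have h1 := h z hz (3 * k + 1) (n + 1) (by positivity) (by positivity)
  have h2 := h z hz (3 * k + 2) (n + 1) (by positivity) (by positivity)
  have hn : ‖(n : ℂ) + 1‖ = n + 1 := by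
    exact_mod_cast Complex.norm_natCast (n + 1)
  push_cast at h1 h2
  simp only [latticeTerm, latticeBound, norm_div, norm_mul, norm_one, hn]
  set x : ℝ := k + 1 with hx
  set m : ℝ := n + 1 with hm
  have hx0 : 0 < x := by positivity
  have hm0 : 0 < m := by positivity
  have hk0 : (0 : ℝ) ≤ k := by positivity
  have hs : x ^ (3 / 2 : ℝ) * m ^ (3 / 2 : ℝ) ≤ m * (x + m) ^ 2 := by
    have e1 : m ^ (3 / 2 : ℝ) = m * m ^ (1 / 2 : ℝ) := by
      rw [show (3 / 2 : ℝ) = 1 + 1 / 2 by norm_num, Real.rpow_add hm0, Real.rpow_one]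
    have e2 : (x + m) ^ 2 = (x + m) ^ (3 / 2 : ℝ) * (x + m) ^ (1 / 2 : ℝ) := by
      rw [← Real.rpow_add (by positivity), ← Real.rpow_natCast]; norm_num
    rw [e1, e2, mul_left_comm]
    gcongr <;> linarith
  rw [div_mul_div_comm, div_mul_div_comm]
  simp only [one_mul]
  apply one_div_le_one_div_of_le (by positivity)
  have h1' : c * (x + m) ≤ ‖(3 * (k : ℂ) + 1) * z + (n + 1)‖ := le_trans (by gcongr; linarith) h1
  have h2' : c * (x + m) ≤ ‖(3 * (k : ℂ) + 2) * z + (n + 1)‖ := le_trans (by gcongr; linarith) h2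
  calc c ^ 2 * (x ^ (3 / 2 : ℝ) * m ^ (3 / 2 : ℝ)) ≤ c ^ 2 * (m * (x + m) ^ 2) := by gcongr
    _ = m * (c * (x + m)) * (c * (x + m)) := by ring
    _ ≤ _ := by gcongr

lemma summable_latticeTerm {z : ℂ} (hz : z ∈ Complex.slitPlane) :
    Summable fun p => latticeTerm p z := by
  obtain ⟨C, hC⟩ := exists_norm_latticeTerm_le (K := {z}) isCompact_singleton (by simpa using hz)
  exact (summable_latticeBound.mul_left C).of_norm_bounded fun p => hC p z rfl

lemma natCast_mul_add_ne_zero {z : ℂ} (hz : z ∈ Complex.slitPlane) (a n : ℕ) :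
    (a : ℂ) * z + (n + 1) ≠ 0 := by
  obtain ⟨c, hc, h⟩ := exists_mul_add_le_norm (K := {z}) isCompact_singleton (by simpa using hz)
  have := h z rfl a (n + 1) (by positivity) (by positivity)
  push_cast at this
  rw [← norm_pos_iff]
  exact lt_of_lt_of_le (by positivity) this

lemma differentiableOn_latticeSum : DifferentiableOn ℂ latticeSum Complex.slitPlane := by
  intro z hz
  obtain ⟨r, hr, hrs⟩ := Metric.nhds_basis_closedBall.mem_iff.1
    (Complex.isOpen_slitPlane.mem_nhds hz)
  obtain ⟨C, hC⟩ := exists_norm_latticeTerm_le (isCompact_closedBall z r) hrs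
  have := Complex.differentiableOn_tsum_of_summable_norm (F := latticeTerm) (U := Metric.ball z r)
    (summable_latticeBound.mul_left C) (fun p w hw => ?_) Metric.isOpen_ball
    (fun p w hw => hC p w (Metric.ball_subset_closedBall hw))
  · exact (this.differentiableAt (Metric.ball_mem_nhds z hr)).differentiableWithinAt
  · have hw' := hrs (Metric.ball_subset_closedBall hw)
    have h1 := natCast_mul_add_ne_zero hw' (3 * p.1 + 1) p.2
    have h2 := natCast_mul_add_ne_zero hw' (3 * p.1 + 2) p.2
    have h3 : (p.2 : ℂ) + 1 ≠ 0 := by exact_mod_cast p.2.succ_ne_zero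
    push_cast at h1 h2
    apply DifferentiableAt.differentiableWithinAt
    unfold latticeTerm
    fun_prop (disch := simp_all)

/-- The partial fraction sum `∑ d : ℤ, χ(d) / (d + w)`, with the classes `1` and `2` paired. -/
def chiCotangent (w : ℂ) : ℂ := ∑' k : ℤ, 1 / ((3 * k + 1 + w) * (3 * k + 2 + w))

lemma chiCotangent_add_three_mul (w : ℂ) (n : ℤ) : chiCotangent (w + 3 * n) = chiCotangent w := by
  rw [chiCotangent, chiCotangent, ← (Equiv.addRight n).tsum_eq
    (fun k : ℤ => 1 / ((3 * (k : ℂ) + 1 + w) * (3 * k + 2 + w)))]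
  refine tsum_congr fun k => ?_
  simp only [Equiv.coe_addRight]
  push_cast
  ring_nf

lemma mem_slitPlane_of_im_pos {y : ℂ} (hy : 0 < y.im) : y ∈ Complex.slitPlane :=
  Complex.mem_slitPlane_iff.2 (Or.inr hy.ne')

lemma neg_mem_slitPlane_of_im_pos {y : ℂ} (hy : 0 < y.im) : -y ∈ Complex.slitPlane :=
  Complex.mem_slitPlane_iff.2 (Or.inr (by simpa using hy.ne'))

lemma sq_mul_latticeSum_add {y : ℂ} (hy : 0 < y.im) :
    y ^ 2 * (latticeSum y + latticeSum (-y)) =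
      ∑' n : ℕ, 1 / ((n : ℂ) + 1) * chiCotangent ((n + 1) / y) := by
  have hy0 : y ≠ 0 := fun h => by simp [h] at hy
  have hs1 := mem_slitPlane_of_im_pos hy
  have hs2 := neg_mem_slitPlane_of_im_pos hy
  have s1 := summable_latticeTerm hs1
  have s2 := summable_latticeTerm hs2
  have s1' := s1.prod_symm
  have s2' := s2.prod_symm
  rw [latticeSum, latticeSum, ← s1.tsum_add s2, ← tsum_mul_left,
    ← (Equiv.prodComm ℕ ℕ).tsum_eq]
  simp only [Equiv.prodComm_apply]
  rw [Summable.tsum_prod ((s1'.add s2').mul_left (y ^ 2))]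
  refine tsum_congr fun n => ?_
  have hn : (n : ℂ) + 1 ≠ 0 := by exact_mod_cast n.succ_ne_zero
  have t1 : ∀ k : ℕ, y ^ 2 * (n + 1) * latticeTerm (k, n) y =
      1 / ((3 * ((k : ℤ) : ℂ) + 1 + (n + 1) / y) * (3 * (k : ℤ) + 2 + (n + 1) / y)) := fun k => by
    have h1 := natCast_mul_add_ne_zero hs1 (3 * k + 1) n
    have h2 := natCast_mul_add_ne_zero hs1 (3 * k + 2) n
    push_cast at h1 h2 ⊢
    have e1 : 3 * (k : ℂ) + 1 + (n + 1) / y = ((3 * k + 1) * y + (n + 1)) / y := by field_simp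
    have e2 : 3 * (k : ℂ) + 2 + (n + 1) / y = ((3 * k + 2) * y + (n + 1)) / y := by field_simp
    rw [e1, e2, latticeTerm]
    field_simp
  have t2 : ∀ k : ℕ, y ^ 2 * (n + 1) * latticeTerm (k, n) (-y) =
      1 / ((3 * ((-(k + 1) : ℤ) : ℂ) + 1 + (n + 1) / y) *
        (3 * ((-(k + 1) : ℤ) : ℂ) + 2 + (n + 1) / y)) := fun k => by
    have h1 := natCast_mul_add_ne_zero hs2 (3 * k + 1) n
    have h2 := natCast_mul_add_ne_zero hs2 (3 * k + 2) n
    push_cast at h1 h2 ⊢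
    have e1 : 3 * (-(k + 1) : ℂ) + 1 + (n + 1) / y = ((3 * k + 2) * (-y) + (n + 1)) / y := by
      field_simp; ring
    have e2 : 3 * (-(k + 1) : ℂ) + 2 + (n + 1) / y = ((3 * k + 1) * (-y) + (n + 1)) / y := by
      field_simp; ring
    rw [e1, e2, latticeTerm]
    field_simp
  have u1 : Summable fun k : ℕ => latticeTerm (k, n) y := s1'.prod_factor n
  have u2 : Summable fun k : ℕ => latticeTerm (k, n) (-y) := s2'.prod_factor n
  have v1 := (u1.mul_left (y ^ 2 * (n + 1))).congr t1
  have v2 := (u2.mul_left (y ^ 2 * (n + 1))).congr t2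
  have hZ := tsum_of_nat_of_neg_add_one
    (f := fun k : ℤ => 1 / ((3 * (k : ℂ) + 1 + (n + 1) / y) * (3 * k + 2 + (n + 1) / y))) v1 v2
  rw [chiCotangent, hZ, ← tsum_congr t1, ← tsum_congr t2,
    tsum_mul_left, tsum_mul_left]
  simp only [Prod.swap_prod_mk]
  rw [tsum_mul_left, u1.tsum_add u2]
  field_simp

lemma sq_mul_latticeSum_add_smul {y : ℂ} (hy : 0 < y.im) (hy' : 0 < (y / (3 * y + 1)).im) :
    (y / (3 * y + 1)) ^ 2 * (latticeSum (y / (3 * y + 1)) + latticeSum (-(y / (3 * y + 1)))) =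
      y ^ 2 * (latticeSum y + latticeSum (-y)) := by
  rw [sq_mul_latticeSum_add hy, sq_mul_latticeSum_add hy']
  refine tsum_congr fun n => ?_
  have hy0 : y ≠ 0 := fun h => by simp [h] at hy
  have : ((n : ℂ) + 1) / (y / (3 * y + 1)) = (n + 1) / y + 3 * ((n + 1 : ℤ) : ℂ) := by
    push_cast
    rw [div_div_eq_mul_div]
    field_simp
    ring
  rw [this, chiCotangent_add_three_mul]

/-- Partial fractions of the Lambert series term `q ^ d / (1 - q ^ d)`. -/
lemma tsum_exp_pow_mul {y : ℂ} (hy : 0 < y.im) (d : ℕ) (hd : d ≠ 0) :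
    ∑' m : ℕ+, Complex.exp (2 * π * Complex.I * y) ^ (d * m : ℕ) =
      -1 / 2 + Complex.I / (2 * π) * (1 / (d * y) +
        ∑' n : ℕ, (1 / (d * y - (n + 1)) + 1 / (d * y + (n + 1)))) := by
  have him : 0 < ((d : ℂ) * y).im := by
    have : (0 : ℝ) < d := by exact_mod_cast Nat.pos_of_ne_zero hd
    simp; positivity
  have h1 := pi_mul_cot_pi_q_exp ⟨d * y, him⟩
  have h2 := cot_series_rep' (UpperHalfPlane.coe_mem_integerComplement ⟨d * y, him⟩)
  have h3 : Summable fun n : ℕ => Complex.exp (2 * π * Complex.I * (d * y)) ^ n :=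
    summable_geometric_of_norm_lt_one (UpperHalfPlane.norm_exp_two_pi_I_lt_one ⟨d * y, him⟩)
  have h5 := tsum_zero_pnat_eq_tsum_nat h3
  have h4 : Complex.exp (2 * π * Complex.I * (d * y)) =
      Complex.exp (2 * π * Complex.I * y) ^ d := by
    rw [← Complex.exp_nat_mul]; congr 1; ring
  simp only [h4, ← pow_mul, pow_zero] at h1 h2 h5
  rw [← h2, h1, ← h5]
  generalize (∑' m : ℕ+, Complex.exp (2 * π * Complex.I * y) ^ (d * m : ℕ)) = A
  have hpi : (π : ℂ) ≠ 0 := by exact_mod_cast Real.pi_ne_zero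
  have : Complex.I / (2 * π) * (π * Complex.I - 2 * π * Complex.I * (1 + A)) = 1 / 2 + A := by
    field_simp
    linear_combination (-1 - 2 * A) * Complex.I_sq
  linear_combination -this

lemma norm_exp_lt_one {y : ℂ} (hy : 0 < y.im) : ‖Complex.exp (2 * π * Complex.I * y)‖ < 1 :=
  UpperHalfPlane.norm_exp_two_pi_I_lt_one ⟨y, hy⟩

lemma norm_chi_div_le_one (a : ℕ+) : ‖(chi a : ℂ) / (a : ℕ)‖ ≤ 1 := by
  have h : ‖(chi a : ℂ)‖ ≤ 1 := by
    unfold chi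
    split_ifs <;> simp
  rw [norm_div, Complex.norm_natCast]
  exact div_le_one_of_le₀ (h.trans (by exact_mod_cast a.pos)) (by positivity)

lemma chi_three_mul_add_one (k : ℕ) : chi ((3 * k + 1 : ℕ) : ℤ) = 1 := by
  rw [chi, if_pos (by omega)]

lemma chi_three_mul_add_two (k : ℕ) : chi ((3 * k + 2 : ℕ) : ℤ) = -1 := by
  rw [chi, if_neg (by omega), if_pos (by omega)]

lemma chi_three_mul_add_three (k : ℕ) : chi ((3 * k + 3 : ℕ) : ℤ) = 0 := by
  rw [chi, if_neg (by omega), if_neg (by omega)]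

lemma summable_chi_div_mul_pow {q : ℂ} (hq : ‖q‖ < 1) :
    Summable fun p : ℕ+ × ℕ+ => (chi p.1 : ℂ) / (p.1 : ℕ) * q ^ (p.1 * p.2 : ℕ) := by
  have h := summable_prod_mul_pow (𝕜 := ℝ) 0 (r := ‖q‖) (by simpa using hq)
  refine h.of_norm_bounded fun p => ?_
  rw [norm_mul, norm_pow, pow_zero, one_mul]
  exact mul_le_of_le_one_left (by positivity) (norm_chi_div_le_one p.1)

lemma tsum_S_mul_pow {q : ℂ} (hq : ‖q‖ < 1) :
    ∑' n : ℕ, S (n + 1) * q ^ (n + 1) = 3 * Real.sqrt 3 * Complex.I *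
      ∑' a : ℕ+, (chi a : ℂ) / (a : ℕ) * ∑' b : ℕ+, q ^ (a * b : ℕ) := by
  have hs := summable_chi_div_mul_pow hq
  have h1 : ∑' a : ℕ+, (chi a : ℂ) / (a : ℕ) * ∑' b : ℕ+, q ^ (a * b : ℕ) =
      ∑' p : ℕ+ × ℕ+, (chi p.1 : ℂ) / (p.1 : ℕ) * q ^ (p.1 * p.2 : ℕ) := by
    rw [hs.tsum_prod]
    exact tsum_congr fun a => tsum_mul_left.symm
  have hs' := (sigmaAntidiagonalEquivProd.summable_iff).2 hs
  rw [h1, ← sigmaAntidiagonalEquivProd.tsum_eq]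
  simp only [Function.comp_def] at hs'
  rw [hs'.tsum_sigma, ← tsum_pnat_eq_tsum_succ (f := fun n => S n * q ^ n), ← tsum_mul_left]
  refine tsum_congr fun n => ?_
  rw [S, mul_assoc]
  congr 1
  simp only [sigmaAntidiagonalEquivProd, divisorsAntidiagonalFactors, PNat.mk_coe,
    Equiv.coe_fn_mk, tsum_fintype, Finset.univ_eq_attach]
  rw [(n : ℕ).divisorsAntidiagonal.sum_attach
    fun x : ℕ × ℕ => (chi x.1 : ℂ) / (x.1 : ℂ) * q ^ (x.1 * x.2),
    Nat.sum_divisorsAntidiagonal fun x z => (chi x : ℂ) / (x : ℂ) * q ^ (x * z), Finset.sum_mul]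
  exact Finset.sum_congr rfl fun i hi => by rw [Nat.mul_div_cancel' (Nat.dvd_of_mem_divisors hi)]

lemma tsum_eq_tsum_three_mul_add {f : ℕ → ℂ} (hf : Summable f) :
    ∑' n, f n = ∑' k, (f (3 * k) + f (3 * k + 1) + f (3 * k + 2)) := by
  have hf' := (Nat.divModEquiv 3).symm.summable_iff.2 hf
  simp only [Function.comp_def] at hf'
  rw [← (Nat.divModEquiv 3).symm.tsum_eq, hf'.tsum_prod]
  refine tsum_congr fun k => ?_
  simp [Fin.sum_univ_three, Nat.divModEquiv, mul_comm]

lemma f0_eq_tsum {y : ℂ} (hy : 0 < y.im) :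
    f0 y = 3 * Real.sqrt 3 * Complex.I * ∑' k : ℕ,
      ((∑' m : ℕ+, Complex.exp (2 * π * Complex.I * y) ^ ((3 * k + 1 : ℕ) * m : ℕ)) /
          (3 * k + 1 : ℕ) -
        (∑' m : ℕ+, Complex.exp (2 * π * Complex.I * y) ^ ((3 * k + 2 : ℕ) * m : ℕ)) /
          (3 * k + 2 : ℕ)) := by
  have hq := norm_exp_lt_one hy
  have hf : f0 y = ∑' n : ℕ, S (n + 1) * Complex.exp (2 * π * Complex.I * y) ^ (n + 1) := by
    refine tsum_congr fun n => ?_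
    rw [← Complex.exp_nat_mul]
    congr 2
    push_cast
    ring
  rw [hf, tsum_S_mul_pow hq]
  congr 1
  set q := Complex.exp (2 * π * Complex.I * y)
  let F : ℕ → ℂ := fun a => (chi a : ℂ) / (a : ℕ) * ∑' b : ℕ+, q ^ (a * b : ℕ)
  have hF : Summable fun a : ℕ+ => F a :=
    (summable_chi_div_mul_pow hq).prod.congr fun a => by
      simp only [F, tsum_mul_left]
  rw [tsum_pnat_eq_tsum_succ (f := F),
    tsum_eq_tsum_three_mul_add (summable_pnat_iff_summable_succ.1 hF)]
  refine tsum_congr fun k => ?_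
  simp only [F, add_assoc, Nat.reduceAdd, chi_three_mul_add_one, chi_three_mul_add_two,
    chi_three_mul_add_three]
  push_cast
  ring

lemma cot_term_sub_cot_term {a b m y : ℂ} (ha : a ≠ 0) (hb : b ≠ 0) (hm : m ≠ 0) (hab : b = a + 1)
    (h1 : a * y + m ≠ 0) (h2 : b * y + m ≠ 0) (h3 : a * y - m ≠ 0) (h4 : b * y - m ≠ 0) :
    (1 / (a * y - m) + 1 / (a * y + m)) * (1 / a) -
        (1 / (b * y - m) + 1 / (b * y + m)) * (1 / b) =
      y ^ 2 * (1 / (m * -(a * y - m) * -(b * y - m)) - 1 / (m * (a * y + m) * (b * y + m))) := by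
  have n1 := mul_ne_zero (mul_ne_zero h3 h1) ha
  have n2 := mul_ne_zero (mul_ne_zero h4 h2) hb
  have n3 := mul_ne_zero (mul_ne_zero hm (neg_ne_zero.2 h3)) (neg_ne_zero.2 h4)
  have n4 := mul_ne_zero (mul_ne_zero hm h1) h2
  rw [div_add_div _ _ h3 h1, div_add_div _ _ h4 h2, div_mul_div_comm, div_mul_div_comm,
    div_sub_div _ _ n1 n2, div_sub_div _ _ n3 n4, mul_div_assoc',
    div_eq_div_iff (mul_ne_zero n1 n2) (mul_ne_zero n3 n4)]
  subst hab
  ring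

lemma f0_term_eq {y : ℂ} (hy : 0 < y.im) (k : ℕ) :
    (∑' m : ℕ+, Complex.exp (2 * π * Complex.I * y) ^ ((3 * k + 1 : ℕ) * m : ℕ)) /
          (3 * k + 1 : ℕ) -
        (∑' m : ℕ+, Complex.exp (2 * π * Complex.I * y) ^ ((3 * k + 2 : ℕ) * m : ℕ)) /
          (3 * k + 2 : ℕ) =
      -1 / 2 * (1 / ((3 * k + 1) * (3 * k + 2))) +
        Complex.I / (2 * π) * ((1 / (3 * k + 1) ^ 2 - 1 / (3 * k + 2) ^ 2) * (1 / y) +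
          y ^ 2 * ((∑' n, latticeTerm (k, n) (-y)) - ∑' n, latticeTerm (k, n) y)) := by
  have hy0 : y ≠ 0 := fun h => by simp [h] at hy
  have hs1 := mem_slitPlane_of_im_pos hy
  have hs2 := neg_mem_slitPlane_of_im_pos hy
  have u1 : Summable fun n : ℕ => latticeTerm (k, n) y := (summable_latticeTerm hs1).prod_factor k
  have u2 : Summable fun n : ℕ => latticeTerm (k, n) (-y) :=
    (summable_latticeTerm hs2).prod_factor k
  have hcot : ∀ d : ℕ, d ≠ 0 →
      Summable fun n : ℕ => 1 / ((d : ℂ) * y - (n + 1)) + 1 / (d * y + (n + 1)) := fun d hd => by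
    have him : 0 < ((d : ℂ) * y).im := by
      have : (0 : ℝ) < d := by exact_mod_cast Nat.pos_of_ne_zero hd
      simp; positivity
    exact summable_cotTerm (UpperHalfPlane.coe_mem_integerComplement ⟨d * y, him⟩)
  have c1 := hcot (3 * k + 1) (by omega)
  have c2 := hcot (3 * k + 2) (by omega)
  have hd1 : 3 * (k : ℂ) + 1 ≠ 0 := by exact_mod_cast (3 * k).succ_ne_zero
  have hd2 : 3 * (k : ℂ) + 2 ≠ 0 := by exact_mod_cast (3 * k + 1).succ_ne_zero
  have key : (∑' n : ℕ, (1 / (((3 * k + 1 : ℕ) : ℂ) * y - (n + 1)) +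
        1 / (((3 * k + 1 : ℕ) : ℂ) * y + (n + 1)))) * (1 / (3 * k + 1)) -
      (∑' n : ℕ, (1 / (((3 * k + 2 : ℕ) : ℂ) * y - (n + 1)) +
        1 / (((3 * k + 2 : ℕ) : ℂ) * y + (n + 1)))) * (1 / (3 * k + 2)) =
      y ^ 2 * ((∑' n, latticeTerm (k, n) (-y)) - ∑' n, latticeTerm (k, n) y) := by
    rw [← tsum_mul_right, ← tsum_mul_right, ← (c1.mul_right _).tsum_sub (c2.mul_right _),
      ← u2.tsum_sub u1, ← tsum_mul_left]
    refine tsum_congr fun n => ?_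
    have hn : (n : ℂ) + 1 ≠ 0 := by exact_mod_cast n.succ_ne_zero
    have h1 := natCast_mul_add_ne_zero hs1 (3 * k + 1) n
    have h2 := natCast_mul_add_ne_zero hs1 (3 * k + 2) n
    have h3 := natCast_mul_add_ne_zero hs2 (3 * k + 1) n
    have h4 := natCast_mul_add_ne_zero hs2 (3 * k + 2) n
    push_cast at h1 h2 h3 h4 ⊢
    have e3 : (3 * (k : ℂ) + 1) * -y + (n + 1) = -((3 * k + 1) * y - (n + 1)) := by ring
    have e4 : (3 * (k : ℂ) + 2) * -y + (n + 1) = -((3 * k + 2) * y - (n + 1)) := by ring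
    rw [e3, neg_ne_zero] at h3
    rw [e4, neg_ne_zero] at h4
    simp only [latticeTerm, e3, e4]
    exact cot_term_sub_cot_term hd1 hd2 hn (by ring) h1 h2 h3 h4
  rw [tsum_exp_pow_mul hy _ (by omega), tsum_exp_pow_mul hy _ (by omega), ← key]
  push_cast
  field_simp
  ring

lemma summable_one_div_three_mul_add_sq (j : ℕ) :
    Summable fun k : ℕ => 1 / (3 * (k : ℂ) + j) ^ 2 := by
  have h := (Real.summable_one_div_nat_pow (p := 2)).2 one_lt_two
  have h' := h.comp_injective (i := fun k : ℕ => 3 * k + j) fun a b hab => by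
    simp only at hab; omega
  refine h'.of_norm_bounded fun k => ?_
  rw [norm_div, norm_one, norm_pow]
  simp only [Function.comp]
  have : ‖3 * (k : ℂ) + j‖ = ((3 * k + j : ℕ) : ℝ) := by
    exact_mod_cast Complex.norm_natCast (3 * k + j)
  rw [this]

lemma summable_one_div_mul : Summable fun k : ℕ => 1 / ((3 * (k : ℂ) + 1) * (3 * k + 2)) := by
  refine (summable_one_div_three_mul_add_sq 1).norm.of_norm_bounded fun k => ?_
  have h1 : ‖3 * (k : ℂ) + 1‖ = 3 * k + 1 := by
    exact_mod_cast Complex.norm_natCast (3 * k + 1)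
  have h2 : ‖3 * (k : ℂ) + 2‖ = 3 * k + 2 := by
    exact_mod_cast Complex.norm_natCast (3 * k + 2)
  rw [norm_div, norm_div, norm_mul, norm_pow, Nat.cast_one, h1, h2, sq]
  gcongr
  norm_num

lemma summable_one_div_sq_sub :
    Summable fun k : ℕ => 1 / (3 * (k : ℂ) + 1) ^ 2 - 1 / (3 * k + 2) ^ 2 := by
  simpa using (summable_one_div_three_mul_add_sq 1).sub (summable_one_div_three_mul_add_sq 2)

lemma exists_f0_eq : ∃ C D : ℂ, ∀ y : ℂ, 0 < y.im → f0 y = 3 * Real.sqrt 3 * Complex.I *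
    (C + Complex.I / (2 * π) * (D * (1 / y) + y ^ 2 * (latticeSum (-y) - latticeSum y))) := by
  refine ⟨∑' k : ℕ, -1 / 2 * (1 / ((3 * (k : ℂ) + 1) * (3 * k + 2))),
    ∑' k : ℕ, (1 / (3 * (k : ℂ) + 1) ^ 2 - 1 / (3 * k + 2) ^ 2), fun y hy => ?_⟩
  have s1 := summable_latticeTerm (mem_slitPlane_of_im_pos hy)
  have s2 := summable_latticeTerm (neg_mem_slitPlane_of_im_pos hy)
  rw [f0_eq_tsum hy, tsum_congr (f0_term_eq hy)]
  have a1 := summable_one_div_mul.mul_left (-1 / 2)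
  have a2 := summable_one_div_sq_sub.mul_right (1 / y)
  have a3 := (s2.prod.sub s1.prod).mul_left (y ^ 2)
  rw [a1.tsum_add ((a2.add a3).mul_left _), tsum_mul_left (a := Complex.I / (2 * π)),
    a2.tsum_add a3, tsum_mul_right, tsum_mul_left (a := y ^ 2), s2.prod.tsum_sub s1.prod,
    ← s2.tsum_prod, ← s1.tsum_prod]
  rfl

lemma im_div_pos {y : ℂ} (hy : 0 < y.im) : 0 < (y / (3 * y + 1)).im := by
  have h : 3 * y + 1 ≠ 0 := fun h => by
    have := congrArg Complex.im h
    simp at this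
    linarith
  have := Complex.normSq_pos.2 h
  rw [Complex.div_im, ← sub_div]
  apply div_pos _ this
  simp
  nlinarith

lemma three_mul_add_one_ne_zero {y : ℂ} (hy : y ∈ Complex.slitPlane) : 3 * y + 1 ≠ 0 := by
  simpa using natCast_mul_add_ne_zero hy 3 0

lemma inv_mem_slitPlane {z : ℂ} (hz : z ∈ Complex.slitPlane) : z⁻¹ ∈ Complex.slitPlane := by
  have := Complex.normSq_pos.2 (Complex.slitPlane_ne_zero hz)
  rw [Complex.mem_slitPlane_iff] at hz ⊢
  rw [Complex.inv_re, Complex.inv_im]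
  exact hz.imp (fun h => by positivity) fun h => div_ne_zero (neg_ne_zero.2 h) this.ne'

lemma div_mem_slitPlane {y : ℂ} (hy : y ∈ Complex.slitPlane) :
    y / (3 * y + 1) ∈ Complex.slitPlane := by
  have hy0 := Complex.slitPlane_ne_zero hy
  have h : (y / (3 * y + 1))⁻¹ = y⁻¹ + 3 := by
    rw [inv_div]
    field_simp
    ring
  rw [← inv_inv (y / (3 * y + 1)), h]
  apply inv_mem_slitPlane
  have hy' := inv_mem_slitPlane hy
  rw [Complex.mem_slitPlane_iff] at hy' ⊢
  refine hy'.imp (fun h => ?_) (fun h => ?_)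
  · rw [Complex.add_re]
    simp only [Complex.re_ofNat]
    linarith
  · simpa using h

/-- The generating function `f₀` of the weak-coupling Stokes constants is a holomorphic
quantum modular function of weight zero for `Γ₁(3)`: the cocycle of `T = [[1,1],[0,1]]`
is trivial, and the cocycle of `γ₃ = [[1,0],[3,1]]` extends holomorphically to the
cut plane `ℂ ∖ ℝ_{≤0} = Complex.slitPlane`. -/
theorem stmt16 :
    (∀ y : ℂ, 0 < y.im → f0 (y + 1) = f0 y) ∧
    ∃ h : ℂ → ℂ, DifferentiableOn ℂ h Complex.slitPlane ∧
      ∀ y : ℂ, 0 < y.im → h y = f0 (y / (3 * y + 1)) - f0 y := by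
  constructor
  · intro y _
    refine tsum_congr fun n => ?_
    rw [mul_add, Complex.exp_add]
    have : Complex.exp (2 * π * Complex.I * (n + 1) * 1) = 1 :=
      Complex.exp_eq_one_iff.2 ⟨n + 1, by push_cast; ring⟩
    rw [this, mul_one]
  obtain ⟨C, D, hf⟩ := exists_f0_eq
  have hd := differentiableOn_latticeSum
  have hg : DifferentiableOn ℂ (fun y : ℂ => y / (3 * y + 1)) Complex.slitPlane := fun y hy => by
    have := three_mul_add_one_ne_zero hy
    fun_prop (disch := assumption)
  have hH : DifferentiableOn ℂ (fun y => 3 * Real.sqrt 3 * Complex.I *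
      (Complex.I / (2 * π) * (D * (1 / y) - 2 * y ^ 2 * latticeSum y))) Complex.slitPlane := by
    have : DifferentiableOn ℂ (fun y : ℂ => 1 / y) Complex.slitPlane := fun y hy => by
      simpa only [one_div] using
        (differentiableAt_inv (Complex.slitPlane_ne_zero hy)).differentiableWithinAt
    fun_prop
  refine ⟨_, (hH.comp hg fun y hy => div_mem_slitPlane hy).sub hH, fun y hy => ?_⟩
  have hy' := im_div_pos hy
  rw [hf y hy, hf _ hy']
  have := sq_mul_latticeSum_add_smul hy hy'
  simp only [Pi.sub_apply, Function.comp]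
  linear_combination (-3 * Real.sqrt 3 * Complex.I * (Complex.I / (2 * π))) * this
end
end
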